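/- Let n ≥ 2 and p > 2. Let f : ℝ^{n+1}\{0} → (0,∞) be a positive C¹ function homogeneous of degree −p. Write M_f = max_{S^n} f, m_f = min_{S^n} f, and G_f = sup_{x ∈ S^n} |∇_{S^n} f(x)|, where ∇_{S^n} f(x) = ∇f(x) − ⟨∇f(x), x⟩ x. Suppose ( 1 + (n(p−1)/(n−1)) · M_f/m_f ) · exp( (p−1) · (nπ/(n−1)) · G_f/m_f ) · G_f ≤ γ_{n,1} · m_f. Then there exists a function u : ℝ^{n+1} → ℝ, convex on ℝ^{n+1}, positive on ℝ^{n+1}\{0}, homogeneous of degree 1, of class C² on ℝ^{n+1}\{0}, satisfying Δu = f u^{p−1} on ℝ^{n+1}\{0}, and such a u is unique. -/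

import Mathlib

open MeasureTheory Metric Set
open scoped RealInnerProductSpace

/-- The Euclidean Laplacian of `u : ℝ^m → ℝ`, as the sum of second partial
derivatives along the standard coordinate directions. -/
noncomputable def laplacian {m : ℕ} (u : EuclideanSpace ℝ (Fin m) → ℝ)
    (x : EuclideanSpace ℝ (Fin m)) : ℝ :=
  ∑ i, fderiv ℝ (fun y => fderiv ℝ u y (EuclideanSpace.single i 1)) x (EuclideanSpace.single i 1)

/-- The tangential (spherical) gradient `∇_{Sⁿ} g(x) = ∇g(x) - ⟨∇g(x), x⟩ x`. -/
noncomputable def sphereGrad {m : ℕ} (g : EuclideanSpace ℝ (Fin m) → ℝ)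
    (x : EuclideanSpace ℝ (Fin m)) : EuclideanSpace ℝ (Fin m) :=
  gradient g x - ⟪gradient g x, x⟫ • x

/-- `ω_n`, the total surface measure of the unit sphere `Sⁿ ⊂ ℝ^{n+1}`. -/
noncomputable def omega_n (n : ℕ) : ℝ :=
  ((volume : Measure (EuclideanSpace ℝ (Fin (n + 1)))).toSphere Set.univ).toReal

/-- The constant `γ_{n,α}` of the paper, computed with the fixed unit vector
`e = EuclideanSpace.single 0 1` (the value does not depend on this choice). -/
noncomputable def gammaConst (n : ℕ) (α : ℝ) : ℝ :=
  omega_n n / (n * (n + 1)) *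
    (∫ y : EuclideanSpace ℝ (Fin (n + 1)),
      (‖y - EuclideanSpace.single (0 : Fin (n + 1)) (1 : ℝ)‖ ^ (n + 1))⁻¹ * ‖y‖⁻¹ *
        Real.arccos ⟪‖y‖⁻¹ • y, EuclideanSpace.single (0 : Fin (n + 1)) (1 : ℝ)⟫ ^ α)⁻¹

section LaplacianCalculus

open Filter Topology

variable {m : ℕ}

local notation "𝔼" => EuclideanSpace ℝ (Fin m)

lemma fderiv_fderiv_apply {u : 𝔼 → ℝ} {x : 𝔼} (h : ContDiffAt ℝ 2 u x) (a b : 𝔼) :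
    fderiv ℝ (fun y => fderiv ℝ u y a) x b = fderiv ℝ (fderiv ℝ u) x b a := by
  have hd : DifferentiableAt ℝ (fderiv ℝ u) x :=
    (h.fderiv_right (m := 1) (by norm_num)).differentiableAt (by norm_num)
  rw [fderiv_clm_apply hd (differentiableAt_const a)]
  simp

lemma laplacian_eq_sum_basis {u : 𝔼 → ℝ} {x : 𝔼} (h : ContDiffAt ℝ 2 u x)
    {ι : Type*} [Fintype ι] (v : OrthonormalBasis ι ℝ 𝔼) :
    laplacian u x = ∑ i, fderiv ℝ (fderiv ℝ u) x (v i) (v i) := by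
  have h1 := congrFun
    (InnerProductSpace.laplacian_eq_iteratedFDeriv_orthonormalBasis u v) x
  have h2 := congrFun
    (InnerProductSpace.laplacian_eq_iteratedFDeriv_orthonormalBasis u
      (EuclideanSpace.basisFun (Fin m) ℝ)) x
  rw [h1] at h2
  simp only [iteratedFDeriv_two_apply, Matrix.cons_val_zero, Matrix.cons_val_one,
    EuclideanSpace.basisFun_apply] at h2
  rw [h2]
  exact Finset.sum_congr rfl fun i _ => fderiv_fderiv_apply h _ _

lemma laplacian_comp_isometry {u : 𝔼 → ℝ} {x : 𝔼} (R : 𝔼 ≃ₗᵢ[ℝ] 𝔼)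
    (h : ContDiffAt ℝ 2 u (R x)) :
    laplacian (fun y => u (R y)) x = laplacian u (R x) := by
  rw [laplacian_eq_sum_basis h ((EuclideanSpace.basisFun (Fin m) ℝ).map R)]
  refine Finset.sum_congr rfl fun i _ => ?_
  have key : ∀ (w : 𝔼 → ℝ) (y a : 𝔼),
      fderiv ℝ (fun z => w (R z)) y a = fderiv ℝ w (R y) (R a) := by
    intro w y a
    have := R.toContinuousLinearEquiv.comp_right_fderiv (f := w) (x := y)
    have h3 := congrArg (fun L => L a) this
    simpa [Function.comp_def] using h3
  have h4 : (fun y => fderiv ℝ (fun z => u (R z)) y (EuclideanSpace.single i 1)) =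
      fun y => (fun z => fderiv ℝ u z (R (EuclideanSpace.single i 1))) (R y) := by
    funext y; exact key u y _
  rw [h4, key (fun z => fderiv ℝ u z (R (EuclideanSpace.single i 1))), fderiv_fderiv_apply h]
  simp

lemma laplacian_congr {u v : 𝔼 → ℝ} {x : 𝔼} (h : u =ᶠ[𝓝 x] v) :
    laplacian u x = laplacian v x := by
  refine Finset.sum_congr rfl fun i _ => ?_
  have : (fun y => fderiv ℝ u y (EuclideanSpace.single i 1)) =ᶠ[𝓝 x]
      fun y => fderiv ℝ v y (EuclideanSpace.single i 1) := by
    filter_upwards [h.fderiv (𝕜 := ℝ)] with y hy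
    rw [hy]
  rw [this.fderiv_eq]

lemma laplacian_eq_trace {u : 𝔼 → ℝ} {x : 𝔼} (h : ContDiffAt ℝ 2 u x) :
    laplacian u x = ∑ i, fderiv ℝ (fderiv ℝ u) x (EuclideanSpace.single i 1)
      (EuclideanSpace.single i 1) :=
  Finset.sum_congr rfl fun _ _ => fderiv_fderiv_apply h _ _

lemma fderiv_differentiableAt {u : 𝔼 → ℝ} {x : 𝔼} (h : ContDiffAt ℝ 2 u x) :
    DifferentiableAt ℝ (fderiv ℝ u) x :=
  (h.fderiv_right (m := 1) (by norm_num)).differentiableAt (by norm_num)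

lemma eventually_differentiableAt {u : 𝔼 → ℝ} {x : 𝔼} (h : ContDiffAt ℝ 2 u x) :
    ∀ᶠ y in 𝓝 x, DifferentiableAt ℝ u y := by
  filter_upwards [h.eventually (by simp)] with y hy
  exact hy.differentiableAt (by norm_num)

lemma laplacian_linear {u v : 𝔼 → ℝ} {x : 𝔼} (hu : ContDiffAt ℝ 2 u x)
    (hv : ContDiffAt ℝ 2 v x) (a b : ℝ) :
    laplacian (fun y => a * u y + b * v y) x = a * laplacian u x + b * laplacian v x := by
  have hw : ContDiffAt ℝ 2 (fun y => a * u y + b * v y) x :=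
    (contDiffAt_const.mul hu).add (contDiffAt_const.mul hv)
  rw [laplacian_eq_trace hw, laplacian_eq_trace hu, laplacian_eq_trace hv, Finset.mul_sum,
    Finset.mul_sum, ← Finset.sum_add_distrib]
  have h1 : fderiv ℝ (fun y => a * u y + b * v y) =ᶠ[𝓝 x]
      fun y => a • fderiv ℝ u y + b • fderiv ℝ v y := by
    filter_upwards [eventually_differentiableAt hu, eventually_differentiableAt hv] with y h1 h2
    rw [fderiv_fun_add (h1.const_mul a) (h2.const_mul b), fderiv_const_mul h1, fderiv_const_mul h2]
  have hdu := fderiv_differentiableAt hu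
  have hdv := fderiv_differentiableAt hv
  rw [h1.fderiv_eq, fderiv_fun_add (hdu.fun_const_smul a) (hdv.fun_const_smul b),
    fderiv_fun_const_smul hdu, fderiv_fun_const_smul hdv]
  simp

/-- The Laplacian of a product. -/
lemma laplacian_mul {u v : 𝔼 → ℝ} {x : 𝔼} (hu : ContDiffAt ℝ 2 u x)
    (hv : ContDiffAt ℝ 2 v x) :
    laplacian (fun y => u y * v y) x = u x * laplacian v x + v x * laplacian u x
      + 2 * ∑ i, fderiv ℝ u x (EuclideanSpace.single i 1) *
          fderiv ℝ v x (EuclideanSpace.single i 1) := by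
  have hw : ContDiffAt ℝ 2 (fun y => u y * v y) x := hu.mul hv
  rw [laplacian_eq_trace hw, laplacian_eq_trace hu, laplacian_eq_trace hv, Finset.mul_sum,
    Finset.mul_sum, Finset.mul_sum, ← Finset.sum_add_distrib, ← Finset.sum_add_distrib]
  have h1 : fderiv ℝ (fun y => u y * v y) =ᶠ[𝓝 x]
      fun y => u y • fderiv ℝ v y + v y • fderiv ℝ u y := by
    filter_upwards [eventually_differentiableAt hu, eventually_differentiableAt hv] with y h1 h2
    rw [fderiv_fun_mul h1 h2]
  have hdu := fderiv_differentiableAt hu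
  have hdv := fderiv_differentiableAt hv
  have hu1 := hu.differentiableAt (by norm_num)
  have hv1 := hv.differentiableAt (by norm_num)
  rw [h1.fderiv_eq, fderiv_fun_add (hu1.fun_smul hdv) (hv1.fun_smul hdu),
    fderiv_fun_smul hu1 hdv, fderiv_fun_smul hv1 hdu]
  refine Finset.sum_congr rfl fun i _ => ?_
  simp
  ring

/-- The Laplacian of a composition with a function of one variable. -/
lemma laplacian_comp {h h' h'' : ℝ → ℝ} {s : 𝔼 → ℝ} {x : 𝔼} (hs : ContDiffAt ℝ 2 s x)
    (hh : ∀ t, HasDerivAt h (h' t) t) (hh' : ∀ t, HasDerivAt h' (h'' t) t)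
    (hc : ContDiff ℝ 2 h) :
    laplacian (fun y => h (s y)) x = h' (s x) * laplacian s x
      + h'' (s x) * ∑ i, fderiv ℝ s x (EuclideanSpace.single i 1) ^ 2 := by
  have hw : ContDiffAt ℝ 2 (fun y => h (s y)) x := hc.contDiffAt.comp x hs
  rw [laplacian_eq_trace hw, laplacian_eq_trace hs, Finset.mul_sum,
    Finset.mul_sum, ← Finset.sum_add_distrib]
  have h1 : fderiv ℝ (fun y => h (s y)) =ᶠ[𝓝 x] fun y => h' (s y) • fderiv ℝ s y := by
    filter_upwards [eventually_differentiableAt hs] with y hy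
    exact ((hh (s y)).comp_hasFDerivAt y hy.hasFDerivAt).fderiv
  have hds := fderiv_differentiableAt hs
  have hs1 := hs.differentiableAt (by norm_num)
  have h2 : HasFDerivAt (fun y => h' (s y)) (h'' (s x) • fderiv ℝ s x) x :=
    (hh' (s x)).comp_hasFDerivAt x hs1.hasFDerivAt
  rw [h1.fderiv_eq, fderiv_fun_smul h2.differentiableAt hds, h2.fderiv]
  refine Finset.sum_congr rfl fun i _ => ?_
  simp
  ring

lemma laplacian_nonpos_of_isLocalMax {u : 𝔼 → ℝ} {x : 𝔼} (h : ContDiffAt ℝ 2 u x)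
    (hmax : IsLocalMax u x) : laplacian u x ≤ 0 := by
  refine Finset.sum_nonpos fun i _ => ?_
  set e : 𝔼 := EuclideanSpace.single i 1
  set q : ℝ → ℝ := fun t => u (x + t • e) with hq
  have hline : ∀ t : ℝ, HasDerivAt (fun t : ℝ => x + t • e) e t := fun t => by
    simpa using ((hasDerivAt_id t).smul_const e).const_add x
  have hcont : Tendsto (fun t : ℝ => x + t • e) (𝓝 0) (𝓝 x) := by
    have := (hline 0).continuousAt.tendsto
    simpa using this
  have hq1 : deriv q =ᶠ[𝓝 0] fun t => fderiv ℝ u (x + t • e) e := by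
    filter_upwards [hcont.eventually (eventually_differentiableAt h)] with t ht
    exact (ht.hasFDerivAt.comp_hasDerivAt t (hline t)).deriv
  have hd : DifferentiableAt ℝ (fun y => fderiv ℝ u y e) x :=
    (fderiv_differentiableAt h).clm_apply (differentiableAt_const e)
  have hq2 : HasDerivAt (fun t : ℝ => fderiv ℝ u (x + t • e) e)
      (fderiv ℝ (fun y => fderiv ℝ u y e) x e) 0 := by
    have hd' : HasFDerivAt (fun y => fderiv ℝ u y e) (fderiv ℝ (fun y => fderiv ℝ u y e) x)
        (x + (0 : ℝ) • e) := by simpa using hd.hasFDerivAt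
    exact hd'.comp_hasDerivAt 0 (hline 0)
  have hqmax : IsLocalMax q 0 := by
    have : ∀ᶠ t in 𝓝 (0 : ℝ), u (x + t • e) ≤ u x := hcont.eventually hmax
    filter_upwards [this] with t ht
    simpa [hq] using ht
  by_contra! hpos
  have hdd : deriv (deriv q) 0 = fderiv ℝ (fun y => fderiv ℝ u y e) x e := by
    rw [hq1.deriv_eq, hq2.deriv]
  have hqc : ContinuousAt q 0 := by
    have h0 : ContinuousAt u (x + (0 : ℝ) • e) := by simpa using h.continuousAt
    exact ContinuousAt.comp (g := u) (f := fun t : ℝ => x + t • e) h0 (hline 0).continuousAt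
  have hmin : IsLocalMin q 0 :=
    isLocalMin_of_deriv_deriv_pos (by rw [hdd]; exact hpos) hqmax.deriv_eq_zero hqc
  have hconst : q =ᶠ[𝓝 0] fun _ => q 0 := by
    filter_upwards [hqmax, hmin] with t h1 h2
    exact le_antisymm h1 h2
  have h3 : deriv q =ᶠ[𝓝 0] fun _ => (0 : ℝ) := by
    filter_upwards [hconst.deriv] with t ht
    simpa using ht
  have h4 : deriv (deriv q) 0 = 0 := by rw [h3.deriv_eq]; simp
  rw [hdd] at h4
  exact absurd h4 hpos.ne'

lemma laplacian_comp_smul {u : 𝔼 → ℝ} {x : 𝔼} {t : ℝ}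
    (h : ContDiffAt ℝ 2 u (t • x)) :
    laplacian (fun y => u (t • y)) x = t ^ 2 * laplacian u (t • x) := by
  have hw : ContDiffAt ℝ 2 (fun y => u (t • y)) x :=
    ContDiffAt.comp x h (contDiffAt_id.const_smul t)
  rw [laplacian_eq_trace hw, laplacian_eq_trace h, Finset.mul_sum]
  have h1 : fderiv ℝ (fun y => u (t • y)) = fun y => t • fderiv ℝ u (t • y) := by
    funext y; exact fderiv_comp_smul t
  have h2 : fderiv ℝ (fun y => fderiv ℝ u (t • y)) x = t • fderiv ℝ (fderiv ℝ u) (t • x) :=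
    fderiv_comp_smul (f := fderiv ℝ u) t
  have hd : DifferentiableAt ℝ (fun y => fderiv ℝ u (t • y)) x :=
    DifferentiableAt.comp x (fderiv_differentiableAt h) (differentiableAt_id.const_smul t)
  rw [h1, fderiv_fun_const_smul hd, h2]
  refine Finset.sum_congr rfl fun i _ => ?_
  simp
  ring

end LaplacianCalculus

section HomogeneousCalculus

open Filter Topology

variable {m : ℕ}

local notation "𝔼" => EuclideanSpace ℝ (Fin m)

/-- Functions homogeneous of degree zero that are `C²` away from the origin. -/
structure IsHomZero (P : EuclideanSpace ℝ (Fin m) → ℝ) : Prop where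
  contDiffOn : ContDiffOn ℝ 2 P {0}ᶜ
  hom : ∀ t : ℝ, 0 < t → ∀ y, y ≠ 0 → P (t • y) = P y

lemma ne_zero_of_mem_unitSphere {x : 𝔼} (hx : x ∈ sphere (0 : 𝔼) 1) : x ≠ 0 :=
  ne_zero_of_mem_unit_sphere ⟨x, hx⟩

lemma contDiffAt_of_contDiffOn_compl {P : 𝔼 → ℝ} {k : WithTop ℕ∞}
    (hP : ContDiffOn ℝ k P {0}ᶜ) {x : 𝔼} (hx : x ≠ 0) : ContDiffAt ℝ k P x :=
  hP.contDiffAt (isOpen_compl_singleton.mem_nhds hx)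

lemma IsHomZero.contDiffAt {P : 𝔼 → ℝ} (hP : IsHomZero P) {x : 𝔼} (hx : x ≠ 0) :
    ContDiffAt ℝ 2 P x :=
  contDiffAt_of_contDiffOn_compl hP.contDiffOn hx

lemma IsHomZero.linear {P Q : 𝔼 → ℝ} (hP : IsHomZero P) (hQ : IsHomZero Q) (a b : ℝ) :
    IsHomZero fun y => a * P y + b * Q y :=
  ⟨(contDiffOn_const.mul hP.contDiffOn).add (contDiffOn_const.mul hQ.contDiffOn),
    fun t ht y hy => by simp only [hP.hom t ht y hy, hQ.hom t ht y hy]⟩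

lemma IsHomZero.comp_isometry {P : 𝔼 → ℝ} (hP : IsHomZero P) (R : 𝔼 ≃ₗᵢ[ℝ] 𝔼) :
    IsHomZero fun y => P (R y) := by
  refine ⟨hP.contDiffOn.comp R.contDiff.contDiffOn fun y hy => ?_, fun t ht y hy => ?_⟩
  · simpa using hy
  · rw [map_smul, hP.hom t ht _ (by simpa using hy)]

lemma isHomZero_const (c : ℝ) : IsHomZero fun _ : 𝔼 => c :=
  ⟨contDiffOn_const, fun _ _ _ _ => rfl⟩

lemma laplacian_const (c : ℝ) (x : 𝔼) : laplacian (fun _ => c) x = 0 := by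
  simp [laplacian]

lemma eq_unit_of_hom {P : 𝔼 → ℝ} (hP : ∀ t : ℝ, 0 < t → ∀ y, y ≠ 0 → P (t • y) = P y)
    {y : 𝔼} (hy : y ≠ 0) : P (‖y‖⁻¹ • y) = P y :=
  hP _ (by positivity) y hy

lemma unit_mem_sphere {y : 𝔼} (hy : y ≠ 0) : ‖y‖⁻¹ • y ∈ sphere (0 : 𝔼) 1 := by
  have := norm_ne_zero_iff.2 hy
  simp [norm_smul, this]

lemma fderiv_apply_self_of_hom {P : 𝔼 → ℝ}
    (hP : ∀ t : ℝ, 0 < t → ∀ y, y ≠ 0 → P (t • y) = P y) {x : 𝔼} (hx : x ≠ 0)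
    (hd : DifferentiableAt ℝ P x) : fderiv ℝ P x x = 0 := by
  have h1 : HasDerivAt (fun t : ℝ => t • x) x 1 := by
    simpa using (hasDerivAt_id (1 : ℝ)).smul_const x
  have h2 : HasDerivAt (fun t : ℝ => P (t • x)) (fderiv ℝ P x x) 1 := by
    have hd' : HasFDerivAt P (fderiv ℝ P x) ((1 : ℝ) • x) := by simpa using hd.hasFDerivAt
    exact hd'.comp_hasDerivAt 1 h1
  have h3 : (fun t : ℝ => P (t • x)) =ᶠ[𝓝 1] fun _ => P x := by
    filter_upwards [lt_mem_nhds (zero_lt_one (α := ℝ))] with t ht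
    exact hP t ht x hx
  have h4 := h2.congr_of_eventuallyEq h3.symm
  exact h4.unique (hasDerivAt_const _ _)

/-- A one-sided maximum principle for `K - Δ` on the sphere. -/
lemma maximum_principle {P : 𝔼 → ℝ} (hP : IsHomZero P) {K c : ℝ} (hK : 0 < K)
    (h : ∀ x ∈ sphere (0 : 𝔼) 1, K * P x - laplacian P x ≤ c) :
    ∀ x ∈ sphere (0 : 𝔼) 1, P x ≤ c / K := by
  intro x hx
  obtain ⟨x₀, hx₀, hmax⟩ := (isCompact_sphere (0 : 𝔼) 1).exists_isMaxOn ⟨x, hx⟩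
    (hP.contDiffOn.continuousOn.mono fun y hy => ne_zero_of_mem_unitSphere hy)
  have hne := ne_zero_of_mem_unitSphere hx₀
  have hloc : IsLocalMax P x₀ := by
    filter_upwards [isOpen_compl_singleton.mem_nhds hne] with y hy
    rw [← eq_unit_of_hom hP.hom hy]
    exact hmax (unit_mem_sphere hy)
  have h1 := laplacian_nonpos_of_isLocalMax (hP.contDiffAt hne) hloc
  have h2 := h x₀ hx₀
  rw [le_div_iff₀ hK]
  have h3 : P x ≤ P x₀ := hmax hx
  nlinarith

lemma inner_eq_sum (a x : 𝔼) : ⟪a, x⟫ = ∑ i, a i * x i := by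
  simp [PiLp.inner_apply, mul_comm]

lemma inner_single_one (a : 𝔼) (i : Fin m) : ⟪a, EuclideanSpace.single i (1 : ℝ)⟫ = a i := by
  simp [EuclideanSpace.inner_single_right]

lemma sum_sq_eq {x : 𝔼} : ∑ i, x i ^ 2 = ‖x‖ ^ 2 := by
  rw [EuclideanSpace.norm_sq_eq]; simp

lemma contDiffAt_norm_two {x : 𝔼} (hx : x ≠ 0) : ContDiffAt ℝ 2 (fun y : 𝔼 => ‖y‖) x :=
  contDiffAt_norm ℝ hx

lemma fderiv_norm_single {x : 𝔼} (hx : x ∈ sphere (0 : 𝔼) 1) (i : Fin m) :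
    fderiv ℝ (fun y : 𝔼 => ‖y‖) x (EuclideanSpace.single i 1) = x i := by
  have hne := ne_zero_of_mem_unitSphere hx
  have hn : ‖x‖ = 1 := by simpa using hx
  have hd : DifferentiableAt ℝ (fun y : 𝔼 => ‖y‖) x :=
    (contDiffAt_norm_two hne).differentiableAt (by norm_num)
  have h1 : HasFDerivAt (fun y : 𝔼 => ‖y‖ * ‖y‖) _ x := hd.hasFDerivAt.mul hd.hasFDerivAt
  have h2 := (hasStrictFDerivAt_norm_sq x).hasFDerivAt
  simp only [pow_two] at h2
  have h3 := congrArg (fun L => L (EuclideanSpace.single i 1)) (h1.unique h2)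
  simp [hn, inner_single_one] at h3
  linarith

lemma laplacian_clm (L : 𝔼 →L[ℝ] ℝ) (x : 𝔼) : laplacian (fun y => L y) x = 0 := by
  simp [laplacian]

lemma laplacian_norm {n : ℕ} {x : EuclideanSpace ℝ (Fin (n + 1))}
    (hx : x ∈ sphere (0 : EuclideanSpace ℝ (Fin (n + 1))) 1) :
    laplacian (fun y : EuclideanSpace ℝ (Fin (n + 1)) => ‖y‖) x = n := by
  have hne := ne_zero_of_mem_unitSphere hx
  have hn : ‖x‖ = 1 := by simpa using hx
  have h1 := laplacian_mul (contDiffAt_norm_two hne) (contDiffAt_norm_two hne)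
  simp only [fderiv_norm_single hx, hn] at h1
  have h2 : laplacian (fun y : EuclideanSpace ℝ (Fin (n + 1)) => ‖y‖ * ‖y‖) x = 2 * (n + 1) := by
    have h3 : fderiv ℝ (fun y : EuclideanSpace ℝ (Fin (n + 1)) => ‖y‖ * ‖y‖) =
        fun y => 2 • innerSL ℝ y := by
      funext y
      have := (hasStrictFDerivAt_norm_sq y).hasFDerivAt
      simp only [pow_two] at this
      exact this.fderiv
    rw [laplacian, h3]
    have : ∀ i : Fin (n + 1), (fun y : EuclideanSpace ℝ (Fin (n + 1)) =>
        (2 • innerSL ℝ y) (EuclideanSpace.single i (1 : ℝ))) =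
        fun y => ((2 : ℝ) • innerSL ℝ (EuclideanSpace.single i (1 : ℝ))) y := by
      intro i; funext y; simp [real_inner_comm]
    simp only [this, ContinuousLinearMap.fderiv]
    simp
    ring
  rw [h2] at h1
  have h4 : ∑ i, x i * x i = 1 := by
    have := sum_sq_eq (x := x)
    simpa [pow_two, hn] using this
  rw [h4] at h1
  linarith

/-- The degree zero extension of the linear function `⟪a, ·⟫` on the sphere. -/
noncomputable def ridge (a y : EuclideanSpace ℝ (Fin m)) : ℝ := ⟪a, y⟫ * ‖y‖⁻¹

lemma ridge_of_mem {a x : 𝔼} (hx : x ∈ sphere (0 : 𝔼) 1) : ridge a x = ⟪a, x⟫ := by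
  have hn : ‖x‖ = 1 := by simpa using hx
  simp [ridge, hn]

lemma ridge_isHomZero (a : 𝔼) : IsHomZero (ridge a) := by
  constructor
  · intro x hx
    have hx' : x ≠ 0 := hx
    refine ContDiffAt.contDiffWithinAt ?_
    exact (contDiffAt_const.inner ℝ contDiffAt_id).mul
      ((contDiffAt_norm_two hx').inv (norm_ne_zero_iff.2 hx'))
  · intro t ht y hy
    have := norm_ne_zero_iff.2 hy
    simp only [ridge, norm_smul, inner_smul_right, Real.norm_eq_abs, abs_of_pos ht]
    field_simp

lemma fderiv_ridge_single {a x : 𝔼} (hx : x ∈ sphere (0 : 𝔼) 1) (i : Fin m) :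
    fderiv ℝ (ridge a) x (EuclideanSpace.single i 1) = a i - ⟪a, x⟫ * x i := by
  have hne := ne_zero_of_mem_unitSphere hx
  have hn : ‖x‖ = 1 := by simpa using hx
  have hd : DifferentiableAt ℝ (fun y : 𝔼 => ‖y‖) x :=
    (contDiffAt_norm_two hne).differentiableAt (by norm_num)
  have hs := ((ridge_isHomZero a).contDiffAt hne).differentiableAt (by norm_num)
  have h1 : HasFDerivAt (fun y : 𝔼 => ridge a y * ‖y‖) _ x := hs.hasFDerivAt.mul hd.hasFDerivAt
  have h2 : (fun y : 𝔼 => ridge a y * ‖y‖) =ᶠ[𝓝 x] fun y => innerSL ℝ a y := by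
    filter_upwards [isOpen_compl_singleton.mem_nhds hne] with y hy
    have := norm_ne_zero_iff.2 (show y ≠ 0 from hy)
    simp [ridge, this]
  have h3 := h1.congr_of_eventuallyEq h2.symm
  have h4 := congrArg (fun L => L (EuclideanSpace.single i 1))
    (h3.unique (innerSL ℝ a).hasFDerivAt)
  simp [hn, fderiv_norm_single hx, ridge_of_mem hx, inner_single_one] at h4
  linarith

lemma laplacian_ridge {n : ℕ} {a x : EuclideanSpace ℝ (Fin (n + 1))}
    (hx : x ∈ sphere (0 : EuclideanSpace ℝ (Fin (n + 1))) 1) :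
    laplacian (ridge a) x = -(n * ⟪a, x⟫) := by
  have hne := ne_zero_of_mem_unitSphere hx
  have hn : ‖x‖ = 1 := by simpa using hx
  have h1 := laplacian_mul ((ridge_isHomZero a).contDiffAt hne) (contDiffAt_norm_two hne)
  have h2 : (fun y => ridge a y * ‖y‖) =ᶠ[𝓝 x] fun y => innerSL ℝ a y := by
    filter_upwards [isOpen_compl_singleton.mem_nhds hne] with y hy
    have := norm_ne_zero_iff.2 (show y ≠ 0 from hy)
    simp [ridge, this]
  rw [laplacian_congr h2, laplacian_clm, laplacian_norm hx, hn, ridge_of_mem hx] at h1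
  simp only [fderiv_norm_single hx, fderiv_ridge_single hx] at h1
  have h5 : ∑ i, (a i - ⟪a, x⟫ * x i) * x i = 0 := by
    have h6 : ∀ i, (a i - ⟪a, x⟫ * x i) * x i = a i * x i - ⟪a, x⟫ * x i ^ 2 := fun i => by ring
    simp only [h6, Finset.sum_sub_distrib, ← Finset.mul_sum, sum_sq_eq, hn, ← inner_eq_sum]
    ring
  rw [h5] at h1
  linarith

/-- The spherical Laplacian of a function of `⟪a, ·⟫`. -/
lemma laplacian_comp_ridge {n : ℕ} {a x : EuclideanSpace ℝ (Fin (n + 1))}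
    (hx : x ∈ sphere (0 : EuclideanSpace ℝ (Fin (n + 1))) 1) {h h' h'' : ℝ → ℝ}
    (hh : ∀ t, HasDerivAt h (h' t) t) (hh' : ∀ t, HasDerivAt h' (h'' t) t)
    (hc : ContDiff ℝ 2 h) :
    laplacian (fun y => h (ridge a y)) x =
      (‖a‖ ^ 2 - ⟪a, x⟫ ^ 2) * h'' ⟪a, x⟫ - n * ⟪a, x⟫ * h' ⟪a, x⟫ := by
  have hn : ‖x‖ = 1 := by simpa using hx
  rw [laplacian_comp ((ridge_isHomZero a).contDiffAt (ne_zero_of_mem_unitSphere hx)) hh hh' hc,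
    laplacian_ridge hx]
  simp only [fderiv_ridge_single hx, ridge_of_mem hx]
  have h6 : ∀ i, (a i - ⟪a, x⟫ * x i) ^ 2 =
      a i ^ 2 - 2 * ⟪a, x⟫ * (a i * x i) + ⟪a, x⟫ ^ 2 * x i ^ 2 := fun i => by ring
  simp only [h6, Finset.sum_add_distrib, Finset.sum_sub_distrib, ← Finset.mul_sum, sum_sq_eq, hn,
    ← inner_eq_sum]
  ring

lemma isHomZero_comp_ridge (a : 𝔼) {h : ℝ → ℝ} (hc : ContDiff ℝ 2 h) :
    IsHomZero fun y => h (ridge a y) :=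
  ⟨hc.comp_contDiffOn (ridge_isHomZero a).contDiffOn,
    fun t ht y hy => by rw [(ridge_isHomZero a).hom t ht y hy]⟩

end HomogeneousCalculus

section TwoPoint

open Filter Topology

lemma barrier_hasDerivAt (t : ℝ) :
    HasDerivAt (fun s : ℝ => 17 / 8 * s - s ^ 2 + 3 / 8 * s ^ 3)
      (17 / 8 - 2 * t + 9 / 8 * t ^ 2) t := by
  have h := (((hasDerivAt_id t).const_mul (17 / 8 : ℝ)).sub (hasDerivAt_pow 2 t)).add
    ((hasDerivAt_pow 3 t).const_mul (3 / 8 : ℝ))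
  refine h.congr_deriv ?_
  norm_num
  ring

lemma barrier_hasDerivAt' (t : ℝ) :
    HasDerivAt (fun s : ℝ => 17 / 8 - 2 * s + 9 / 8 * s ^ 2) (-2 + 9 / 4 * t) t := by
  have h := (((hasDerivAt_id t).const_mul (2 : ℝ)).const_sub (17 / 8 : ℝ)).add
    ((hasDerivAt_pow 2 t).const_mul (9 / 8 : ℝ))
  refine h.congr_deriv ?_
  norm_num
  ring

lemma barrier_inequality {n : ℝ} (hn : 2 ≤ n) {t : ℝ} (h0 : 0 ≤ t) :
    (1 - t ^ 2) * (-2 + 9 / 4 * t) - n * t * (17 / 8 - 2 * t + 9 / 8 * t ^ 2) ≤ -2 := by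
  have h1 : 0 ≤ (n - 2) * (t * (17 / 8 - 2 * t + 9 / 8 * t ^ 2)) :=
    mul_nonneg (by linarith) (mul_nonneg h0 (by nlinarith [sq_nonneg (t - 8 / 9)]))
  nlinarith [mul_nonneg h0 (sq_nonneg (3 * t - 2))]

variable {n : ℕ}

local notation "𝔼" => EuclideanSpace ℝ (Fin (n + 1))

/-- A two-point estimate for functions with bounded spherical Laplacian, by reflection. -/
lemma two_point_estimate (hn : 2 ≤ n) {P : 𝔼 → ℝ} (hP : IsHomZero P) {Q : ℝ}
    (hQ : ∀ x ∈ sphere (0 : 𝔼) 1, |laplacian P x| ≤ Q) {x y : 𝔼}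
    (hx : x ∈ sphere (0 : 𝔼) 1) (hy : y ∈ sphere (0 : 𝔼) 1) :
    P x - P y ≤ Q * (17 / 8 * (‖x - y‖ / 2) - (‖x - y‖ / 2) ^ 2 + 3 / 8 * (‖x - y‖ / 2) ^ 3) := by
  rcases eq_or_ne x y with rfl | hxy
  · simp
  set h : ℝ → ℝ := fun s => 17 / 8 * s - s ^ 2 + 3 / 8 * s ^ 3 with hh
  have hc : ContDiff ℝ 2 h := by fun_prop
  have hd : 0 < ‖x - y‖ := norm_pos_iff.2 (sub_ne_zero.2 hxy)
  have hx1 : ‖x‖ = 1 := by simpa using hx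
  have hy1 : ‖y‖ = 1 := by simpa using hy
  set k : 𝔼 := ‖x - y‖⁻¹ • (x - y) with hk
  have hk1 : ‖k‖ = 1 := by
    rw [hk, norm_smul, norm_inv, norm_norm, inv_mul_cancel₀ hd.ne']
  set ρ : 𝔼 ≃ₗᵢ[ℝ] 𝔼 := (ℝ ∙ k)ᗮ.reflection with hρ
  have hρa : ∀ z, ρ z = z - (2 * ⟪k, z⟫) • k := by
    intro z
    rw [hρ, Submodule.reflection_orthogonal_apply, Submodule.reflection_singleton_apply, hk1]
    simp [mul_smul, two_smul]
  have hsq : ‖x - y‖ ^ 2 = 2 - 2 * ⟪x, y⟫ := by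
    rw [norm_sub_sq_real, hx1, hy1]; ring
  have hkx : ⟪k, x⟫ = ‖x - y‖ / 2 := by
    rw [hk, real_inner_smul_left, inner_sub_left, real_inner_self_eq_norm_sq, hx1,
      real_inner_comm]
    field_simp
    linarith
  have hρx : ρ x = y := by
    rw [hρa, hkx, hk, smul_smul]
    have : 2 * (‖x - y‖ / 2) * ‖x - y‖⁻¹ = 1 := by field_simp
    rw [this]; simp
  have hQ0 : 0 ≤ Q := (abs_nonneg _).trans (hQ x hx)
  suffices H : ∀ ε > 0, P x - P y ≤ (Q + ε) * h (‖x - y‖ / 2) by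
    have ht : Tendsto (fun ε : ℝ => (Q + ε) * h (‖x - y‖ / 2)) (𝓝[>] 0)
        (𝓝 ((Q + 0) * h (‖x - y‖ / 2))) := by
      have : Continuous (fun ε : ℝ => (Q + ε) * h (‖x - y‖ / 2)) := by fun_prop
      exact (this.tendsto 0).mono_left nhdsWithin_le_nhds
    have := ge_of_tendsto ht (eventually_nhdsWithin_of_forall H)
    simpa using this
  intro ε hε
  set w : 𝔼 → ℝ := fun z => 1 * (1 * P z + (-1) * P (ρ z)) + (-(Q + ε)) * h (ridge k z) with hw
  have hPρ : IsHomZero fun z => P (ρ z) := hP.comp_isometry ρ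
  have hh0 : IsHomZero fun z => h (ridge k z) := isHomZero_comp_ridge k hc
  have hdiff := hP.linear hPρ 1 (-1)
  have hwH : IsHomZero w := hdiff.linear hh0 1 (-(Q + ε))
  have hcomp : IsCompact (sphere (0 : 𝔼) 1 ∩ {z | 0 ≤ ⟪k, z⟫}) :=
    (isCompact_sphere _ _).inter_right (isClosed_le continuous_const (by fun_prop))
  have hxm : x ∈ sphere (0 : 𝔼) 1 ∩ {z | 0 ≤ ⟪k, z⟫} := ⟨hx, by
    simp only [mem_ofPred_eq, hkx]; positivity⟩
  obtain ⟨z, hz, hmax⟩ := hcomp.exists_isMaxOn ⟨x, hxm⟩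
    (hwH.contDiffOn.continuousOn.mono fun z hz => ne_zero_of_mem_unitSphere hz.1)
  have hzne := ne_zero_of_mem_unitSphere hz.1
  have hwz : w z ≤ 0 := by
    rcases (show (0 : ℝ) ≤ ⟪k, z⟫ from hz.2).eq_or_lt with h0 | hpos
    · have : ρ z = z := by rw [hρa, ← h0]; simp
      simp [hw, this, ridge_of_mem hz.1, ← h0, hh]
    · exfalso
      have hloc : IsLocalMax w z := by
        have hev : ∀ᶠ y in 𝓝 z, 0 < ⟪k, y⟫ :=
          (isOpen_lt continuous_const (by fun_prop)).mem_nhds hpos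
        filter_upwards [isOpen_compl_singleton.mem_nhds hzne, hev] with y hy hy2
        rw [← eq_unit_of_hom hwH.hom hy]
        refine hmax ⟨unit_mem_sphere hy, ?_⟩
        simp only [mem_ofPred_eq, inner_smul_right]
        positivity
      have h1 := laplacian_nonpos_of_isLocalMax (hwH.contDiffAt hzne) hloc
      have hρz : ρ z ∈ sphere (0 : 𝔼) 1 := by simpa using hz.1
      have hk2 : ⟪k, z⟫ ≤ 1 := by
        have := real_inner_le_norm k z
        have hz1 : ‖z‖ = 1 := by simpa using hz.1
        rwa [hk1, hz1, one_mul] at this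
      rw [laplacian_linear (hdiff.contDiffAt hzne) (hh0.contDiffAt hzne),
        laplacian_linear (hP.contDiffAt hzne) (hPρ.contDiffAt hzne),
        laplacian_comp_isometry ρ (hP.contDiffAt (ne_zero_of_mem_unitSphere hρz)),
        laplacian_comp_ridge hz.1 barrier_hasDerivAt barrier_hasDerivAt' hc, hk1] at h1
      have h2 := barrier_inequality (n := n) (by exact_mod_cast hn) hpos.le
      have h3 := abs_le.1 (hQ z hz.1)
      have h4 := abs_le.1 (hQ _ hρz)
      have h5 := mul_le_mul_of_nonneg_left h2 (by linarith : 0 ≤ Q + ε)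
      simp only [one_pow] at h1
      linarith
  have := (show w x ≤ w z from hmax hxm).trans hwz
  simp only [hw, hρx, ridge_of_mem hx, hkx] at this
  linarith

lemma two_point_lipschitz (hn : 2 ≤ n) {P : 𝔼 → ℝ} (hP : IsHomZero P) {Q : ℝ}
    (hQ : ∀ x ∈ sphere (0 : 𝔼) 1, |laplacian P x| ≤ Q) {x y : 𝔼}
    (hx : x ∈ sphere (0 : 𝔼) 1) (hy : y ∈ sphere (0 : 𝔼) 1) :
    P x - P y ≤ 17 / 16 * Q * ‖x - y‖ := by
  refine (two_point_estimate hn hP hQ hx hy).trans ?_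
  have hQ0 : 0 ≤ Q := (abs_nonneg _).trans (hQ x hx)
  have hx1 : ‖x‖ = 1 := by simpa using hx
  have hy1 : ‖y‖ = 1 := by simpa using hy
  have h1 : ‖x - y‖ / 2 ≤ 1 := by linarith [norm_sub_le x y]
  have h0 : 0 ≤ ‖x - y‖ / 2 := by positivity
  set s := ‖x - y‖ / 2
  have : 17 / 16 * Q * ‖x - y‖ = Q * (17 / 8 * s) := by ring
  rw [this]
  refine mul_le_mul_of_nonneg_left ?_ hQ0
  nlinarith [mul_nonneg (sq_nonneg s) (sub_nonneg.2 h1)]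

lemma two_point_oscillation (hn : 2 ≤ n) {P : 𝔼 → ℝ} (hP : IsHomZero P) {Q : ℝ}
    (hQ : ∀ x ∈ sphere (0 : 𝔼) 1, |laplacian P x| ≤ Q) {x y : 𝔼}
    (hx : x ∈ sphere (0 : 𝔼) 1) (hy : y ∈ sphere (0 : 𝔼) 1) :
    P x - P y ≤ 3 / 2 * Q := by
  refine (two_point_estimate hn hP hQ hx hy).trans ?_
  have hQ0 : 0 ≤ Q := (abs_nonneg _).trans (hQ x hx)
  have hx1 : ‖x‖ = 1 := by simpa using hx
  have hy1 : ‖y‖ = 1 := by simpa using hy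
  have h1 : ‖x - y‖ / 2 ≤ 1 := by linarith [norm_sub_le x y]
  have h0 : 0 ≤ ‖x - y‖ / 2 := by positivity
  set s := ‖x - y‖ / 2
  rw [mul_comm (3 / 2 : ℝ)]
  refine mul_le_mul_of_nonneg_left ?_ hQ0
  nlinarith [mul_nonneg (sub_nonneg.2 h1) (sq_nonneg (s - 5 / 6))]

lemma norm_unit_sub_le {m : ℕ} {x y : EuclideanSpace ℝ (Fin m)} (hx : x ≠ 0) (hy : y ≠ 0) :
    ‖‖y‖⁻¹ • y - ‖x‖⁻¹ • x‖ ≤ 2 * ‖y - x‖ / ‖x‖ := by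
  have hx' := norm_pos_iff.2 hx
  have hy' := norm_pos_iff.2 hy
  have h1 : ‖y‖⁻¹ • y - ‖x‖⁻¹ • x =
      ‖x‖⁻¹ • ((y - x) + (‖x‖ - ‖y‖) • (‖y‖⁻¹ • y)) := by
    match_scalars <;> field_simp
    ring
  have h2 : ‖‖y‖⁻¹ • y‖ = 1 := by simpa using unit_mem_sphere hy
  rw [h1, norm_smul, norm_inv, norm_norm, inv_mul_eq_div]
  gcongr
  calc _ ≤ ‖y - x‖ + ‖(‖x‖ - ‖y‖) • (‖y‖⁻¹ • y)‖ := norm_add_le _ _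
    _ ≤ ‖y - x‖ + ‖y - x‖ := by
      rw [norm_smul, h2, mul_one, Real.norm_eq_abs, norm_sub_rev y x]
      gcongr
      exact abs_norm_sub_norm_le x y
    _ = _ := by ring

lemma norm_fderiv_le_of_hom {m : ℕ} {P : EuclideanSpace ℝ (Fin m) → ℝ}
    (hP : ∀ t : ℝ, 0 < t → ∀ y, y ≠ 0 → P (t • y) = P y) {L : ℝ} (hL0 : 0 ≤ L)
    (hL : ∀ x ∈ sphere (0 : EuclideanSpace ℝ (Fin m)) 1,
      ∀ y ∈ sphere (0 : EuclideanSpace ℝ (Fin m)) 1, |P x - P y| ≤ L * ‖x - y‖)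
    {x : EuclideanSpace ℝ (Fin m)} (hx : x ≠ 0) : ‖fderiv ℝ P x‖ ≤ 2 * L / ‖x‖ := by
  refine norm_fderiv_le_of_lip' ℝ (by positivity) ?_
  filter_upwards [isOpen_compl_singleton.mem_nhds hx] with y hy
  rw [← eq_unit_of_hom hP hx, ← eq_unit_of_hom hP hy, Real.norm_eq_abs]
  refine (hL _ (unit_mem_sphere hy) _ (unit_mem_sphere hx)).trans ?_
  calc _ ≤ L * (2 * ‖y - x‖ / ‖x‖) := by gcongr; exact norm_unit_sub_le hx hy
    _ = _ := by ring

end TwoPoint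

section ResolventRelation

open Filter Topology

variable {n : ℕ}

local notation "𝔼" => EuclideanSpace ℝ (Fin (n + 1))
local notation "𝕊" => sphere (0 : EuclideanSpace ℝ (Fin (n + 1))) 1

/-- The closure of the relation `K u - Δ u = g` on the sphere under uniform convergence. -/
def Resolves (K : ℝ) (u g : EuclideanSpace ℝ (Fin (n + 1)) → ℝ) : Prop :=
  ∀ ε > 0, ∃ P, IsHomZero P ∧ ∀ x ∈ sphere (0 : EuclideanSpace ℝ (Fin (n + 1))) 1,
    |P x - u x| ≤ ε ∧ |K * P x - laplacian P x - g x| ≤ ε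

variable {K : ℝ} {u v g h : EuclideanSpace ℝ (Fin (n + 1)) → ℝ}

lemma IsHomZero.resolves {P : 𝔼 → ℝ} (hP : IsHomZero P) (K : ℝ) :
    Resolves K P fun x => K * P x - laplacian P x :=
  fun ε hε => ⟨P, hP, fun x _ => by simp [hε.le]⟩

lemma Resolves.linear (hu : Resolves K u g) (hv : Resolves K v h) (a b : ℝ) :
    Resolves K (fun x => a * u x + b * v x) fun x => a * g x + b * h x := by
  intro ε hε
  have hc : 0 < |a| + |b| + 1 := by positivity
  obtain ⟨P, hP, hP'⟩ := hu (ε / (|a| + |b| + 1)) (by positivity)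
  obtain ⟨Q, hQ, hQ'⟩ := hv (ε / (|a| + |b| + 1)) (by positivity)
  have key : ∀ r s : ℝ, |r| ≤ ε / (|a| + |b| + 1) → |s| ≤ ε / (|a| + |b| + 1) →
      |a * r + b * s| ≤ ε := by
    intro r s hr hs
    calc |a * r + b * s| ≤ |a| * |r| + |b| * |s| := by
          rw [← abs_mul, ← abs_mul]; exact abs_add_le _ _
      _ ≤ |a| * (ε / (|a| + |b| + 1)) + |b| * (ε / (|a| + |b| + 1)) := by gcongr
      _ = ε * ((|a| + |b|) / (|a| + |b| + 1)) := by ring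
      _ ≤ ε * 1 := by
        gcongr
        rw [div_le_one hc]; linarith
      _ = ε := mul_one ε
  refine ⟨_, hP.linear hQ a b, fun x hx => ⟨?_, ?_⟩⟩
  · convert key _ _ (hP' x hx).1 (hQ' x hx).1 using 2
    ring
  · have hne := ne_zero_of_mem_unitSphere hx
    rw [laplacian_linear (hP.contDiffAt hne) (hQ.contDiffAt hne)]
    convert key _ _ (hP' x hx).2 (hQ' x hx).2 using 2
    ring

lemma Resolves.le_of_le (hK : 0 < K) (hu : Resolves K u g) {c : ℝ} (hc : ∀ x ∈ 𝕊, g x ≤ c) :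
    ∀ x ∈ 𝕊, u x ≤ c / K := by
  intro x hx
  refine le_of_forall_pos_le_add fun ε hε => ?_
  obtain ⟨P, hP, hP'⟩ := hu (ε / (1 / K + 1)) (by positivity)
  have h1 := maximum_principle hP (c := c + ε / (1 / K + 1)) hK (fun y hy => by
    linarith [abs_le.1 (hP' y hy).2, hc y hy]) x hx
  have h2 := abs_le.1 (hP' x hx).1
  have h3 : ε / (1 / K + 1) / K + ε / (1 / K + 1) = ε := by field_simp
  rw [add_div] at h1
  linarith

lemma Resolves.mono (hK : 0 < K) (hu : Resolves K u g) (hv : Resolves K v h)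
    (hgh : ∀ x ∈ 𝕊, g x ≤ h x) : ∀ x ∈ 𝕊, u x ≤ v x := by
  intro x hx
  have := (hu.linear hv 1 (-1)).le_of_le hK (c := 0) (fun y hy => by linarith [hgh y hy]) x hx
  simp only [zero_div] at this
  linarith

lemma resolves_const (K c : ℝ) : Resolves (n := n) K (fun _ => c) fun _ => K * c := by
  simpa [laplacian_const] using (isHomZero_const (m := n + 1) c).resolves K

lemma Resolves.congr (hu : Resolves K u g) (h1 : ∀ x ∈ 𝕊, u x = v x) (h2 : ∀ x ∈ 𝕊, g x = h x) :
    Resolves K v h := by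
  intro ε hε
  obtain ⟨P, hP, hP'⟩ := hu ε hε
  exact ⟨P, hP, fun x hx => by rw [← h1 x hx, ← h2 x hx]; exact hP' x hx⟩

lemma Resolves.comp_isometry (hu : Resolves K u g) (R : 𝔼 ≃ₗᵢ[ℝ] 𝔼) :
    Resolves K (fun x => u (R x)) fun x => g (R x) := by
  intro ε hε
  obtain ⟨P, hP, hP'⟩ := hu ε hε
  refine ⟨_, hP.comp_isometry R, fun x hx => ?_⟩
  have hRx : R x ∈ 𝕊 := by simpa using hx
  rw [laplacian_comp_isometry R (hP.contDiffAt (ne_zero_of_mem_unitSphere hRx))]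
  exact hP' _ hRx

lemma resolves_of_approx (H : ∀ ε > 0, ∃ v h, Resolves K v h ∧ ∀ x ∈ 𝕊,
    |v x - u x| ≤ ε ∧ |h x - g x| ≤ ε) : Resolves K u g := by
  intro ε hε
  obtain ⟨v, h, hv, hvh⟩ := H (ε / 2) (by positivity)
  obtain ⟨P, hP, hP'⟩ := hv (ε / 2) (by positivity)
  refine ⟨P, hP, fun x hx => ⟨?_, ?_⟩⟩
  · have h1 := abs_le.1 (hP' x hx).1
    have h2 := abs_le.1 (hvh x hx).1
    exact abs_le.2 ⟨by linarith, by linarith⟩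
  · have h1 := abs_le.1 (hP' x hx).2
    have h2 := abs_le.1 (hvh x hx).2
    exact abs_le.2 ⟨by linarith, by linarith⟩

lemma abs_laplacian_le (hK : 0 < K) {P : 𝔼 → ℝ} (hP : IsHomZero P) {B : ℝ}
    (hB : ∀ x ∈ 𝕊, |K * P x - laplacian P x| ≤ B) : ∀ x ∈ 𝕊, |laplacian P x| ≤ 2 * B := by
  have hr := hP.resolves K
  have h1 := hr.le_of_le hK (c := B) fun x hx => (abs_le.1 (hB x hx)).2
  have h2 := (hr.linear hr (-1) 0).le_of_le hK (c := B) fun x hx => by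
    linarith [(abs_le.1 (hB x hx)).1]
  intro x hx
  have h3 := h1 x hx
  have h4 := h2 x hx
  rw [le_div_iff₀ hK] at h3 h4
  have h5 := abs_le.1 (hB x hx)
  exact abs_le.2 ⟨by linarith, by linarith⟩

lemma Resolves.lipschitz (hn : 2 ≤ n) (hK : 0 < K) (hu : Resolves K u g) {B : ℝ}
    (hB : ∀ x ∈ 𝕊, |g x| ≤ B) {x y : 𝔼} (hx : x ∈ 𝕊) (hy : y ∈ 𝕊) :
    |u x - u y| ≤ 17 / 8 * B * ‖x - y‖ := by
  have main : ∀ x ∈ 𝕊, ∀ y ∈ 𝕊, u x - u y ≤ 17 / 8 * B * ‖x - y‖ := by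
    intro x hx y hy
    refine le_of_forall_pos_le_add fun ε hε => ?_
    set c := 17 / 8 * ‖x - y‖ + 2 with hc
    have hc0 : 0 < c := by positivity
    obtain ⟨P, hP, hP'⟩ := hu (ε / c) (by positivity)
    have h1 := abs_laplacian_le hK hP (B := B + ε / c) fun z hz => by
      have h1 := abs_le.1 (hP' z hz).2
      have h2 := abs_le.1 (hB z hz)
      exact abs_le.2 ⟨by linarith, by linarith⟩
    have h2 := two_point_lipschitz hn hP h1 hx hy
    have h3 := abs_le.1 (hP' x hx).1
    have h4 := abs_le.1 (hP' y hy).1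
    have h5 : ε / c * c = ε := by field_simp
    rw [hc] at h5
    rw [hc] at h2 h3 h4
    linarith
  refine abs_le.2 ⟨?_, main x hx y hy⟩
  have := main y hy x hx
  rw [norm_sub_rev] at this
  linarith

lemma fderiv_linear {m : ℕ} {P Q : EuclideanSpace ℝ (Fin m) → ℝ} (hP : IsHomZero P)
    (hQ : IsHomZero Q) {x : EuclideanSpace ℝ (Fin m)} (hx : x ≠ 0) :
    fderiv ℝ (fun y => 1 * P y + (-1) * Q y) x = fderiv ℝ P x - fderiv ℝ Q x := by
  have h1 := (hP.contDiffAt hx).differentiableAt (by norm_num)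
  have h2 := (hQ.contDiffAt hx).differentiableAt (by norm_num)
  rw [fderiv_fun_add (h1.const_mul _) (h2.const_mul _), fderiv_const_mul h1, fderiv_const_mul h2]
  simp [sub_eq_add_neg]

/-- Solutions of the resolvent equation in the closure sense are `C¹`. -/
lemma Resolves.contDiffOn_one (hn : 2 ≤ n) (hK : 0 < K) (hu : Resolves K u g)
    (hu0 : ∀ t : ℝ, 0 < t → ∀ y, y ≠ 0 → u (t • y) = u y) :
    ContDiffOn ℝ 1 u {0}ᶜ := by
  set e : ℕ → ℝ := fun k => 1 / (k + 1 : ℝ) with he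
  have he0 : ∀ k, 0 < e k := fun k => by positivity
  have helim : Tendsto e atTop (𝓝 0) := tendsto_one_div_add_atTop_nhds_zero_nat
  choose P hP hP' using fun k => hu (e k) (he0 k)
  have hdiff : ∀ k l, ∀ x : 𝔼, x ≠ 0 →
      ‖fderiv ℝ (P k) x - fderiv ℝ (P l) x‖ ≤ 17 / 4 * (e k + e l) / ‖x‖ := by
    intro k l x hx
    have hH := (hP k).linear (hP l) 1 (-1)
    have h1 := abs_laplacian_le hK hH (B := e k + e l) fun z hz => by
      have hne := ne_zero_of_mem_unitSphere hz
      rw [laplacian_linear ((hP k).contDiffAt hne) ((hP l).contDiffAt hne)]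
      have h1 := abs_le.1 (hP' k z hz).2
      have h2 := abs_le.1 (hP' l z hz).2
      exact abs_le.2 ⟨by linarith, by linarith⟩
    have h2 := norm_fderiv_le_of_hom (P := fun y => 1 * P k y + (-1) * P l y)
      hH.hom (L := 17 / 8 * (e k + e l))
      (by have := he0 k; have := he0 l; positivity)
      (fun y hy z hz => by
        refine abs_le.2 ⟨?_, ?_⟩
        · have := two_point_lipschitz hn hH h1 hz hy
          rw [norm_sub_rev] at this
          linarith
        · have := two_point_lipschitz hn hH h1 hy hz
          linarith) hx
    rw [fderiv_linear (hP k) (hP l) hx] at h2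
    refine h2.trans (le_of_eq ?_)
    ring
  have hcau : ∀ x : 𝔼, x ≠ 0 → CauchySeq fun k => fderiv ℝ (P k) x := by
    intro x hx
    have hb : Tendsto (fun N => 17 / 4 * (e N + e N) / ‖x‖) atTop (𝓝 0) := by
      simpa using ((helim.add helim).const_mul (17 / 4)).div_const ‖x‖
    refine cauchySeq_of_le_tendsto_0 _ (fun k l N hk hl => ?_) hb
    rw [dist_eq_norm]
    refine (hdiff k l x hx).trans ?_
    have hanti : ∀ {N k}, N ≤ k → e k ≤ e N := fun {N k} h => by
      simp only [he]; gcongr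
    gcongr
    · exact hanti hk
    · exact hanti hl
  have hlim : ∀ x : 𝔼, ∃ G : 𝔼 →L[ℝ] ℝ,
      x ≠ 0 → Tendsto (fun k => fderiv ℝ (P k) x) atTop (𝓝 G) := by
    intro x
    by_cases hx : x = 0
    · exact ⟨0, fun h => absurd hx h⟩
    · obtain ⟨G, hG⟩ := cauchySeq_tendsto_of_complete (hcau x hx)
      exact ⟨G, fun _ => hG⟩
  choose G hG using hlim
  have hbound : ∀ k, ∀ x : 𝔼, x ≠ 0 → ‖fderiv ℝ (P k) x - G x‖ ≤ 17 / 4 * e k / ‖x‖ := by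
    intro k x hx
    have h1 := (tendsto_const_nhds (x := fderiv ℝ (P k) x)).sub (hG x hx)
    have h2 : Tendsto (fun l => 17 / 4 * (e k + e l) / ‖x‖) atTop (𝓝 (17 / 4 * (e k + 0) / ‖x‖)) :=
      ((helim.const_add (e k)).const_mul (17 / 4)).div_const ‖x‖
    rw [add_zero] at h2
    exact le_of_tendsto_of_tendsto' h1.norm h2 fun l => hdiff k l x hx
  have hunif : TendstoLocallyUniformlyOn (fun k => fderiv ℝ (P k)) G atTop {0}ᶜ := by
    rw [Metric.tendstoLocallyUniformlyOn_iff]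
    intro ε hε x hx
    have hx0 : 0 < ‖x‖ := norm_pos_iff.2 hx
    refine ⟨{y | ‖x‖ / 2 < ‖y‖}, mem_nhdsWithin_of_mem_nhds
      ((isOpen_lt continuous_const continuous_norm).mem_nhds (by
        simp only [mem_ofPred_eq]; linarith)), ?_⟩
    have hb : Tendsto (fun k => 17 / 4 * e k / (‖x‖ / 2)) atTop (𝓝 0) := by
      simpa using (helim.const_mul (17 / 4)).div_const (‖x‖ / 2)
    filter_upwards [hb.eventually (gt_mem_nhds hε)] with k hk y hy
    have hy' : ‖x‖ / 2 < ‖y‖ := hy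
    have hy0 : 0 < ‖y‖ := by linarith
    rw [dist_comm, dist_eq_norm]
    refine ((hbound k y (norm_pos_iff.1 hy0)).trans ?_).trans_lt hk
    have := he0 k
    gcongr
  have hpt : ∀ x ∈ ({0}ᶜ : Set 𝔼), Tendsto (fun k => P k x) atTop (𝓝 (u x)) := by
    intro x hx
    rw [tendsto_iff_norm_sub_tendsto_zero]
    refine squeeze_zero (fun _ => norm_nonneg _) (fun k => ?_) helim
    rw [← eq_unit_of_hom (hP k).hom hx, ← eq_unit_of_hom hu0 hx]
    exact (hP' k _ (unit_mem_sphere hx)).1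
  have hder : ∀ x ∈ ({0}ᶜ : Set 𝔼), HasFDerivAt u (G x) x := fun x hx =>
    hasFDerivAt_of_tendstoLocallyUniformlyOn isOpen_compl_singleton hunif
      (fun k y hy => (((hP k).contDiffAt hy).differentiableAt (by norm_num)).hasFDerivAt) hpt hx
  have hGc : ContinuousOn G {0}ᶜ := by
    refine hunif.continuousOn (Frequently.of_forall fun k y hy => ?_)
    exact (((hP k).contDiffAt hy).fderiv_right (m := 1) (by norm_num)).continuousAt
      |>.continuousWithinAt
  have : (1 : WithTop ℕ∞) = 0 + 1 := by norm_num
  rw [this, contDiffOn_succ_iff_fderiv_of_isOpen isOpen_compl_singleton]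
  refine ⟨fun x hx => (hder x hx).differentiableAt.differentiableWithinAt, by simp, ?_⟩
  rw [contDiffOn_zero]
  exact hGc.congr fun x hx => (hder x hx).fderiv

end ResolventRelation

section Rotations

open Filter Topology

variable {n : ℕ}

local notation "𝔼" => EuclideanSpace ℝ (Fin (n + 1))
local notation "𝕊" => sphere (0 : EuclideanSpace ℝ (Fin (n + 1))) 1

/-- The infinitesimal rotation in the plane of `a` and `b`. -/
noncomputable def rotGen (a b x : EuclideanSpace ℝ (Fin (n + 1))) :
    EuclideanSpace ℝ (Fin (n + 1)) :=
  ⟪a, x⟫ • b - ⟪b, x⟫ • a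

/-- The rotation by the angle `t` in the plane of `a` and `b`. -/
noncomputable def rotMap (a b : EuclideanSpace ℝ (Fin (n + 1))) (t : ℝ)
    (x : EuclideanSpace ℝ (Fin (n + 1))) : EuclideanSpace ℝ (Fin (n + 1)) :=
  x + (Real.cos t - 1) • (⟪a, x⟫ • a + ⟪b, x⟫ • b) + Real.sin t • rotGen a b x

variable {a b : EuclideanSpace ℝ (Fin (n + 1))}

lemma rotMap_zero (x : 𝔼) : rotMap a b 0 x = x := by simp [rotMap]

lemma rotMap_eq (t : ℝ) (x : 𝔼) : rotMap a b t x =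
    x + ((Real.cos t - 1) * ⟪a, x⟫ - Real.sin t * ⟪b, x⟫) • a
      + ((Real.cos t - 1) * ⟪b, x⟫ + Real.sin t * ⟪a, x⟫) • b := by
  simp only [rotMap, rotGen]
  module

lemma norm_add_smul_add_smul_sq (ha : ‖a‖ = 1) (hb : ‖b‖ = 1) (hab : ⟪a, b⟫ = 0) (x : 𝔼)
    (p q : ℝ) : ‖x + p • a + q • b‖ ^ 2 =
      ‖x‖ ^ 2 + p ^ 2 + q ^ 2 + 2 * p * ⟪a, x⟫ + 2 * q * ⟪b, x⟫ := by
  rw [norm_add_sq_real, norm_add_sq_real]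
  simp only [inner_add_left, inner_smul_left, inner_smul_right, norm_smul, mul_pow, ha, hb, hab,
    Real.norm_eq_abs, sq_abs, real_inner_comm a x, real_inner_comm b x]
  simp
  ring

lemma inner_sq_add_inner_sq_le (ha : ‖a‖ = 1) (hb : ‖b‖ = 1) (hab : ⟪a, b⟫ = 0) (x : 𝔼) :
    ⟪a, x⟫ ^ 2 + ⟪b, x⟫ ^ 2 ≤ ‖x‖ ^ 2 := by
  have h := norm_add_smul_add_smul_sq ha hb hab x (-⟪a, x⟫) (-⟪b, x⟫)
  nlinarith [sq_nonneg ‖x + (-⟪a, x⟫) • a + (-⟪b, x⟫) • b‖]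

lemma norm_rotMap (ha : ‖a‖ = 1) (hb : ‖b‖ = 1) (hab : ⟪a, b⟫ = 0) (t : ℝ) (x : 𝔼) :
    ‖rotMap a b t x‖ = ‖x‖ := by
  have h : ‖rotMap a b t x‖ ^ 2 = ‖x‖ ^ 2 := by
    rw [rotMap_eq, norm_add_smul_add_smul_sq ha hb hab]
    linear_combination (⟪a, x⟫ ^ 2 + ⟪b, x⟫ ^ 2) * Real.sin_sq_add_cos_sq t
  exact (sq_eq_sq₀ (norm_nonneg _) (norm_nonneg _)).1 h

lemma norm_rotMap_sub_le (ha : ‖a‖ = 1) (hb : ‖b‖ = 1) (hab : ⟪a, b⟫ = 0) (t : ℝ) {x : 𝔼}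
    (hx : ‖x‖ = 1) : ‖rotMap a b t x - x‖ ≤ |t| := by
  have h : ‖rotMap a b t x - x‖ ^ 2 ≤ |t| ^ 2 := by
    have h1 : rotMap a b t x - x = 0 + ((Real.cos t - 1) * ⟪a, x⟫ - Real.sin t * ⟪b, x⟫) • a
        + ((Real.cos t - 1) * ⟪b, x⟫ + Real.sin t * ⟪a, x⟫) • b := by
      rw [rotMap_eq]; abel
    rw [h1, norm_add_smul_add_smul_sq ha hb hab, sq_abs]
    simp only [norm_zero, inner_zero_right]
    have h2 := inner_sq_add_inner_sq_le ha hb hab x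
    have h3 := Real.one_sub_sq_div_two_le_cos (x := t)
    have h4 := Real.cos_le_one t
    have h5 := Real.sin_sq_add_cos_sq t
    rw [hx] at h2
    nlinarith
  exact abs_le_of_sq_le_sq' h (abs_nonneg t) |>.2

/-- Rotations as linear isometries. -/
noncomputable def rotIso (ha : ‖a‖ = 1) (hb : ‖b‖ = 1) (hab : ⟪a, b⟫ = 0) (t : ℝ) :
    EuclideanSpace ℝ (Fin (n + 1)) ≃ₗᵢ[ℝ] EuclideanSpace ℝ (Fin (n + 1)) :=
  LinearIsometry.toLinearIsometryEquiv
    { toFun := rotMap a b t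
      map_add' := fun x y => by
        simp only [rotMap, rotGen, inner_add_right]; module
      map_smul' := fun c x => by
        simp only [rotMap, rotGen, inner_smul_right, RingHom.id_apply]; module
      norm_map' := norm_rotMap ha hb hab t } rfl

lemma rotIso_apply (ha : ‖a‖ = 1) (hb : ‖b‖ = 1) (hab : ⟪a, b⟫ = 0) (t : ℝ) (x : 𝔼) :
    rotIso ha hb hab t x = rotMap a b t x := rfl

lemma hasDerivAt_rotMap (ha : ‖a‖ = 1) (hb : ‖b‖ = 1) (hab : ⟪a, b⟫ = 0) (x : 𝔼) (t : ℝ) :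
    HasDerivAt (fun t => rotMap a b t x) (rotGen a b (rotMap a b t x)) t := by
  have h1 : HasDerivAt (fun t => rotMap a b t x)
      ((-Real.sin t) • (⟪a, x⟫ • a + ⟪b, x⟫ • b) + Real.cos t • rotGen a b x) t :=
    ((((Real.hasDerivAt_cos t).sub_const 1).smul_const _).const_add x).add
      ((Real.hasDerivAt_sin t).smul_const _)
  refine h1.congr_deriv ?_
  have hab' : ⟪b, a⟫ = 0 := by rw [real_inner_comm]; exact hab
  rw [rotMap_eq]
  simp only [rotGen, inner_add_right, inner_smul_right, hab, hab', real_inner_self_eq_norm_sq, ha,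
    hb]
  module

lemma inner_rotGen_self (x : 𝔼) : ⟪rotGen a b x, x⟫ = 0 := by
  simp only [rotGen, inner_sub_left, inner_smul_left]
  simp
  ring

lemma norm_rotGen_le (ha : ‖a‖ = 1) (hb : ‖b‖ = 1) (hab : ⟪a, b⟫ = 0) (x : 𝔼) :
    ‖rotGen a b x‖ ≤ ‖x‖ := by
  have h1 : rotGen a b x = 0 + (-⟪b, x⟫) • a + ⟪a, x⟫ • b := by
    simp only [rotGen]; module
  have h := norm_add_smul_add_smul_sq ha hb hab 0 (-⟪b, x⟫) ⟪a, x⟫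
  rw [← h1] at h
  simp only [norm_zero, inner_zero_right] at h
  have h2 := inner_sq_add_inner_sq_le ha hb hab x
  exact abs_le_of_sq_le_sq' (by linarith) (norm_nonneg x) |>.2

lemma continuous_rotGen : Continuous (rotGen a b) := by
  unfold rotGen; fun_prop

lemma continuous_rotMap : Continuous fun p : ℝ × 𝔼 => rotMap a b p.1 p.2 := by
  unfold rotMap rotGen; fun_prop

lemma rotMap_ne_zero (ha : ‖a‖ = 1) (hb : ‖b‖ = 1) (hab : ⟪a, b⟫ = 0) (t : ℝ) {x : 𝔼}
    (hx : x ≠ 0) : rotMap a b t x ≠ 0 := by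
  rw [← norm_ne_zero_iff, norm_rotMap ha hb hab]; exact norm_ne_zero_iff.2 hx

lemma hasDerivAt_comp_rotMap (ha : ‖a‖ = 1) (hb : ‖b‖ = 1) (hab : ⟪a, b⟫ = 0) {g : 𝔼 → ℝ}
    (hg : ContDiffOn ℝ 1 g {0}ᶜ) {x : 𝔼} (hx : x ≠ 0) (t : ℝ) :
    HasDerivAt (fun t => g (rotMap a b t x))
      (fderiv ℝ g (rotMap a b t x) (rotGen a b (rotMap a b t x))) t :=
  ((contDiffAt_of_contDiffOn_compl hg (rotMap_ne_zero ha hb hab t hx)).differentiableAt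
    (by norm_num)).hasFDerivAt.comp_hasDerivAt t (hasDerivAt_rotMap ha hb hab x t)

lemma rotation_quotient_tendsto (ha : ‖a‖ = 1) (hb : ‖b‖ = 1) (hab : ⟪a, b⟫ = 0) {g : 𝔼 → ℝ}
    (hg : ContDiffOn ℝ 1 g {0}ᶜ) {ε : ℝ} (hε : 0 < ε) :
    ∃ δ > 0, ∀ t, 0 < t → t ≤ δ → ∀ x ∈ 𝕊,
      |(g (rotMap a b t x) - g x) / t - fderiv ℝ g x (rotGen a b x)| ≤ ε := by
  set Φ : ℝ × 𝔼 → ℝ := fun p => fderiv ℝ g (rotMap a b p.1 p.2) (rotGen a b (rotMap a b p.1 p.2))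
    with hΦ
  have hfd : ContinuousOn (fderiv ℝ g) {0}ᶜ :=
    hg.continuousOn_fderiv_of_isOpen isOpen_compl_singleton (by norm_num)
  have hΦc : ContinuousOn Φ (Icc (-1) 1 ×ˢ 𝕊) := by
    refine ContinuousOn.clm_apply (hfd.comp continuous_rotMap.continuousOn fun p hp => ?_)
      (continuous_rotGen.comp continuous_rotMap).continuousOn
    exact rotMap_ne_zero ha hb hab _ (ne_zero_of_mem_unitSphere hp.2)
  have huc :=
    (isCompact_Icc.prod (isCompact_sphere (0 : 𝔼) 1)).uniformContinuousOn_of_continuous hΦc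
  rw [Metric.uniformContinuousOn_iff] at huc
  obtain ⟨δ, hδ, H⟩ := huc ε hε
  refine ⟨min (δ / 2) 1, by positivity, fun t ht htδ x hx => ?_⟩
  have hx0 := ne_zero_of_mem_unitSphere hx
  have hder : ∀ s ∈ Icc (0 : ℝ) t, HasDerivWithinAt (fun s => g (rotMap a b s x) - s * Φ (0, x))
      (Φ (s, x) - Φ (0, x)) (Icc 0 t) s := fun s _ => by
    have := (hasDerivAt_comp_rotMap ha hb hab hg hx0 s).sub
      ((hasDerivAt_id s).mul_const (Φ (0, x)))
    exact this.hasDerivWithinAt.congr_deriv (by simp [hΦ])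
  have hbd : ∀ s ∈ Icc (0 : ℝ) t, ‖Φ (s, x) - Φ (0, x)‖ ≤ ε := by
    intro s hs
    have h1 : s ≤ δ / 2 := hs.2.trans (htδ.trans (min_le_left _ _))
    have h2 : s ≤ 1 := hs.2.trans (htδ.trans (min_le_right _ _))
    refine (H (s, x) ⟨⟨by linarith [hs.1], h2⟩, hx⟩ (0, x) ⟨by simp, hx⟩ ?_).le
    rw [Prod.dist_eq]
    simp only [dist_self, Real.dist_eq, sub_zero, abs_of_nonneg hs.1]
    rw [max_lt_iff]
    exact ⟨by linarith, hδ⟩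
  have h3 := (convex_Icc (0 : ℝ) t).norm_image_sub_le_of_norm_hasDerivWithin_le hder hbd
    (left_mem_Icc.2 ht.le) (right_mem_Icc.2 ht.le)
  simp only [hΦ, rotMap_zero, Real.norm_eq_abs, sub_zero, zero_mul, abs_of_pos ht] at h3
  have h4 : (g (rotMap a b t x) - g x) / t - fderiv ℝ g x (rotGen a b x) =
      (g (rotMap a b t x) - t * fderiv ℝ g x (rotGen a b x) - g x) / t := by
    field_simp
    ring
  rw [h4, abs_div, abs_of_pos ht, div_le_iff₀ ht]
  exact h3

lemma Resolves.rotation_deriv (ha : ‖a‖ = 1) (hb : ‖b‖ = 1) (hab : ⟪a, b⟫ = 0) {K : ℝ}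
    {u g : 𝔼 → ℝ} (h : Resolves K u g) (hu : ContDiffOn ℝ 1 u {0}ᶜ) (hg : ContDiffOn ℝ 1 g {0}ᶜ) :
    Resolves K (fun x => fderiv ℝ u x (rotGen a b x)) fun x => fderiv ℝ g x (rotGen a b x) := by
  refine resolves_of_approx fun ε hε => ?_
  obtain ⟨δ₁, h₁, H₁⟩ := rotation_quotient_tendsto ha hb hab hu hε
  obtain ⟨δ₂, h₂, H₂⟩ := rotation_quotient_tendsto ha hb hab hg hε
  set t := min δ₁ δ₂
  have ht : 0 < t := by positivity
  refine ⟨_, _, (h.comp_isometry (rotIso ha hb hab t)).linear h (1 / t) (-(1 / t)),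
    fun x hx => ⟨?_, ?_⟩⟩
  · convert H₁ t ht (min_le_left _ _) x hx using 2
    rw [rotIso_apply]; ring
  · convert H₂ t ht (min_le_right _ _) x hx using 2
    rw [rotIso_apply]; ring

lemma fderiv_smul_of_hom {m : ℕ} {P : EuclideanSpace ℝ (Fin m) → ℝ}
    (hP : ∀ t : ℝ, 0 < t → ∀ y, y ≠ 0 → P (t • y) = P y) {t : ℝ} (ht : 0 < t)
    {y : EuclideanSpace ℝ (Fin m)} (hy : y ≠ 0) :
    t • fderiv ℝ P (t • y) = fderiv ℝ P y := by
  rw [← fderiv_comp_smul (f := P) t (x := y)]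
  refine Filter.EventuallyEq.fderiv_eq ?_
  filter_upwards [isOpen_compl_singleton.mem_nhds hy] with z hz
  exact hP t ht z hz

lemma sum_coord_smul {m : ℕ} (x : EuclideanSpace ℝ (Fin m)) :
    ∑ i, x i • EuclideanSpace.single i (1 : ℝ) = x := by
  simpa using (EuclideanSpace.basisFun (Fin m) ℝ).sum_repr x

/-- Solutions with a `C¹` right hand side are `C²`. -/
lemma Resolves.contDiffOn_two (hn : 2 ≤ n) {K : ℝ} (hK : 0 < K) {u g : 𝔼 → ℝ}
    (h : Resolves K u g) (hu0 : ∀ t : ℝ, 0 < t → ∀ y, y ≠ 0 → u (t • y) = u y)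
    (hg : ContDiffOn ℝ 1 g {0}ᶜ) : ContDiffOn ℝ 2 u {0}ᶜ := by
  have hu := h.contDiffOn_one hn hK hu0
  set D : Fin (n + 1) → Fin (n + 1) → 𝔼 → ℝ := fun i j x =>
    fderiv ℝ u x (rotGen (EuclideanSpace.single i 1) (EuclideanSpace.single j 1) x) with hD
  have hDC : ∀ i j, ContDiffOn ℝ 1 (D i j) {0}ᶜ := by
    intro i j
    by_cases hij : i = j
    · subst hij
      have : D i i = fun _ => 0 := by funext x; simp [hD, rotGen]
      rw [this]; exact contDiffOn_const
    · refine (h.rotation_deriv (by simp) (by simp) ?_ hu hg).contDiffOn_one hn hK ?_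
      · rw [inner_single_one]; simp [Ne.symm hij]
      · intro t ht y hy
        simp only [hD]
        rw [← fderiv_smul_of_hom hu0 ht hy]
        simp only [rotGen, inner_smul_right, smul_apply, ← map_smul]
        congr 1
        module
  have hpart : ∀ j, ContDiffOn ℝ 1 (fun x => fderiv ℝ u x (EuclideanSpace.single j 1)) {0}ᶜ := by
    intro j
    have h1 : ContDiffOn ℝ 1 (fun x : 𝔼 => (‖x‖ ^ 2)⁻¹ * ∑ i, x i * D i j x) {0}ᶜ := by
      refine ContDiffOn.mul (ContDiffOn.inv (contDiff_norm_sq ℝ).contDiffOn fun x hx => ?_)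
        (ContDiffOn.sum fun i _ => ContDiffOn.mul ?_ (hDC i j))
      · have : ‖x‖ ≠ 0 := norm_ne_zero_iff.2 hx
        positivity
      · exact (contDiff_piLp_apply (p := 2)).contDiffOn
    refine h1.congr fun x hx => ?_
    have hx0 : ‖x‖ ≠ 0 := norm_ne_zero_iff.2 hx
    have h2 : ∀ i, x i * D i j x = fderiv ℝ u x (EuclideanSpace.single j 1) * x i ^ 2
        - x j * fderiv ℝ u x (x i • EuclideanSpace.single i (1 : ℝ)) := by
      intro i
      simp only [hD, rotGen, map_sub, map_smul, real_inner_comm x, inner_single_one, smul_eq_mul]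
      ring
    have h4 := fderiv_apply_self_of_hom hu0 hx
      ((contDiffAt_of_contDiffOn_compl hu hx).differentiableAt (by norm_num))
    simp only [h2, Finset.sum_sub_distrib, ← Finset.mul_sum, sum_sq_eq, ← map_sum,
      sum_coord_smul, h4]
    field_simp
    ring
  have hfd : ContDiffOn ℝ 1 (fderiv ℝ u) {0}ᶜ := by
    have h1 : ContDiffOn ℝ 1 (fun x => ∑ j, fderiv ℝ u x (EuclideanSpace.single j 1) •
        innerSL ℝ (EuclideanSpace.single j (1 : ℝ) : 𝔼)) {0}ᶜ :=
      ContDiffOn.sum fun j _ => (hpart j).smul contDiffOn_const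
    refine h1.congr fun x _ => ?_
    ext v
    conv_lhs => rw [← sum_coord_smul v]
    simp [inner_single_one, real_inner_comm v, mul_comm]
  have : (2 : WithTop ℕ∞) = 1 + 1 := by norm_num
  rw [this, contDiffOn_succ_iff_fderiv_of_isOpen isOpen_compl_singleton]
  exact ⟨hu.differentiableOn (by norm_num), by simp, hfd⟩

/-- The relation is closable: the image of the zero function vanishes. -/
lemma Resolves.nonpos_of_zero {K : ℝ} (hK : 0 < K) {q : 𝔼 → ℝ} (h : Resolves K (fun _ => 0) q)
    (hq : ContinuousOn q 𝕊) : ∀ x ∈ 𝕊, q x ≤ 0 := by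
  intro x₀ hx₀
  by_contra! hpos
  set c := q x₀ / 2 with hc
  have hc0 : 0 < c := by positivity
  obtain ⟨r, hr, hball⟩ := Metric.continuousOn_iff.1 hq x₀ hx₀ c hc0
  have hx₀1 : ‖x₀‖ = 1 := by simpa using hx₀
  set η := c / (2 * (n + 1)) with hη
  have hη0 : 0 < η := by positivity
  set ε := min (η * r ^ 2 / 8) (c / (4 * (K + 1))) with hε
  have hε0 : 0 < ε := by positivity
  have hε1 : ε ≤ η * r ^ 2 / 8 := min_le_left _ _
  have hε2 : (K + 1) * ε ≤ c / 4 := by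
    have : ε ≤ c / (4 * (K + 1)) := min_le_right _ _
    rw [le_div_iff₀ (by positivity)] at this
    linarith
  obtain ⟨P, hP, hP'⟩ := h ε hε0
  have hW := hP.linear (ridge_isHomZero x₀) (-1) η
  obtain ⟨x₁, hx₁, hmax⟩ := (isCompact_sphere (0 : 𝔼) 1).exists_isMaxOn ⟨x₀, hx₀⟩
    (hW.contDiffOn.continuousOn.mono fun y hy => ne_zero_of_mem_unitSphere hy)
  have hne := ne_zero_of_mem_unitSphere hx₁
  have hx₁1 : ‖x₁‖ = 1 := by simpa using hx₁
  have hloc : IsLocalMax (fun y => (-1) * P y + η * ridge x₀ y) x₁ := by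
    filter_upwards [isOpen_compl_singleton.mem_nhds hne] with y hy
    have := eq_unit_of_hom (P := fun y => (-1) * P y + η * ridge x₀ y) hW.hom hy
    rw [← this]
    exact hmax (unit_mem_sphere hy)
  have h1 := laplacian_nonpos_of_isLocalMax (hW.contDiffAt hne) hloc
  rw [laplacian_linear (hP.contDiffAt hne) ((ridge_isHomZero x₀).contDiffAt hne),
    laplacian_ridge hx₁] at h1
  have h2 : (-1) * P x₀ + η * ridge x₀ x₀ ≤ (-1) * P x₁ + η * ridge x₀ x₁ := hmax hx₀
  rw [ridge_of_mem hx₀, ridge_of_mem hx₁, real_inner_self_eq_norm_sq, hx₀1] at h2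
  have h3 := abs_le.1 (hP' x₀ hx₀).1
  have h4 := abs_le.1 (hP' x₁ hx₁).1
  have h5 := abs_le.1 (hP' x₁ hx₁).2
  have h6 : ‖x₁ - x₀‖ ^ 2 = 2 - 2 * ⟪x₀, x₁⟫ := by
    rw [norm_sub_sq_real, hx₀1, hx₁1, real_inner_comm]; ring
  have h7 : ‖x₁ - x₀‖ < r := by
    by_contra! hge
    have : r ^ 2 ≤ ‖x₁ - x₀‖ ^ 2 := by gcongr
    nlinarith
  have h8 := hball x₁ hx₁ (by rwa [dist_eq_norm])
  rw [Real.dist_eq] at h8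
  have h9 := (abs_lt.1 h8).1
  have h10 : ⟪x₀, x₁⟫ ≤ 1 := by
    have := real_inner_le_norm x₀ x₁
    rwa [hx₀1, hx₁1, one_mul] at this
  have h11 : η * (n * ⟪x₀, x₁⟫) ≤ c / 2 := by
    calc η * (n * ⟪x₀, x₁⟫) ≤ η * (n * 1) := by gcongr
      _ ≤ η * (n + 1) := by gcongr; linarith
      _ = c / 2 := by rw [hη]; field_simp
  have h12 : K * P x₁ ≤ K * ε := by gcongr; linarith
  linarith

lemma Resolves.laplacian_eq {K : ℝ} (hK : 0 < K) {u g : 𝔼 → ℝ} (h : Resolves K u g)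
    (hu : IsHomZero u) (hg : ContinuousOn g 𝕊) :
    ∀ x ∈ 𝕊, laplacian u x = K * u x - g x := by
  have hsub : 𝕊 ⊆ {0}ᶜ := fun y hy => ne_zero_of_mem_unitSphere hy
  have hΔ : ContinuousOn (laplacian u) 𝕊 := by
    have hfd : ContDiffOn ℝ 1 (fderiv ℝ u) {0}ᶜ :=
      hu.contDiffOn.fderiv_of_isOpen isOpen_compl_singleton (by norm_num)
    have hfd2 : ContinuousOn (fderiv ℝ (fderiv ℝ u)) {0}ᶜ :=
      hfd.continuousOn_fderiv_of_isOpen isOpen_compl_singleton (by norm_num)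
    have : ContinuousOn (fun x => ∑ i, fderiv ℝ (fderiv ℝ u) x (EuclideanSpace.single i 1)
        (EuclideanSpace.single i 1)) {0}ᶜ := by fun_prop
    exact (this.congr fun x hx => laplacian_eq_trace (hu.contDiffAt hx)).mono hsub
  have hq : ContinuousOn (fun x => g x - (K * u x - laplacian u x)) 𝕊 :=
    hg.sub ((continuousOn_const.mul (hu.contDiffOn.continuousOn.mono hsub)).sub hΔ)
  intro x hx
  have h1 := Resolves.nonpos_of_zero hK ((h.linear (hu.resolves K) 1 (-1)).congr
    (fun y _ => by ring) (fun y _ => by ring)) hq x hx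
  have h2 := Resolves.nonpos_of_zero hK (q := fun x => -(g x - (K * u x - laplacian u x)))
    ((h.linear (hu.resolves K) (-1) 1).congr (fun y _ => by ring) (fun y _ => by ring)) hq.neg x hx
  linarith

end Rotations

section Existence

open Filter Topology

variable {n : ℕ}

local notation "𝔼" => EuclideanSpace ℝ (Fin (n + 1))
local notation "𝕊" => sphere (0 : EuclideanSpace ℝ (Fin (n + 1))) 1

/-- The range of `K - Δ` acting on functions on the sphere. -/
def resolventRange (n : ℕ) (K : ℝ) :
    Submodule ℝ C(sphere (0 : EuclideanSpace ℝ (Fin (n + 1))) 1, ℝ) where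
  carrier := {g | ∃ P : EuclideanSpace ℝ (Fin (n + 1)) → ℝ, IsHomZero P ∧
    ∀ x : sphere (0 : EuclideanSpace ℝ (Fin (n + 1))) 1, g x = K * P x - laplacian P x}
  add_mem' := by
    rintro f g ⟨P, hP, hf⟩ ⟨Q, hQ, hg⟩
    refine ⟨_, hP.linear hQ 1 1, fun x => ?_⟩
    have hne := ne_zero_of_mem_unitSphere x.2
    rw [laplacian_linear (hP.contDiffAt hne) (hQ.contDiffAt hne), ContinuousMap.add_apply, hf, hg]
    ring
  zero_mem' := ⟨_, isHomZero_const 0, fun x => by simp [laplacian_const]⟩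
  smul_mem' := by
    rintro c f ⟨P, hP, hf⟩
    refine ⟨_, hP.linear hP c 0, fun x => ?_⟩
    have hne := ne_zero_of_mem_unitSphere x.2
    rw [laplacian_linear (hP.contDiffAt hne) (hP.contDiffAt hne), ContinuousMap.smul_apply, hf,
      smul_eq_mul]
    ring

/-- The restriction of a linear function to the sphere. -/
noncomputable def sphereLinear (a : EuclideanSpace ℝ (Fin (n + 1))) :
    C(sphere (0 : EuclideanSpace ℝ (Fin (n + 1))) 1, ℝ) :=
  ⟨fun x => ⟪a, x⟫, by fun_prop⟩

lemma sphereLinear_pow_mem {K : ℝ} (hK : 0 < K) (a : 𝔼) (k : ℕ) :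
    sphereLinear a ^ k ∈ resolventRange n K := by
  induction k using Nat.strong_induction_on with
  | _ k ih =>
    have hd : ∀ t : ℝ, HasDerivAt (fun s : ℝ => s ^ k) (k * t ^ (k - 1)) t := hasDerivAt_pow k
    have hd' : ∀ t : ℝ, HasDerivAt (fun s : ℝ => (k : ℝ) * s ^ (k - 1))
        (k * ((k - 1 : ℕ) * t ^ (k - 1 - 1))) t := fun t => (hasDerivAt_pow (k - 1) t).const_mul _
    have hc : ContDiff ℝ 2 fun s : ℝ => s ^ k := contDiff_id.pow k
    set A : ℝ := K + k * (k - 1 : ℕ) + n * k with hA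
    have hA0 : 0 < A := by positivity
    have h1 : A • sphereLinear a ^ k - ((k : ℝ) * (k - 1 : ℕ) * ‖a‖ ^ 2) • sphereLinear a ^ (k - 2)
        ∈ resolventRange n K := by
      refine ⟨_, isHomZero_comp_ridge a hc, fun x => ?_⟩
      rw [laplacian_comp_ridge x.2 hd hd' hc, ridge_of_mem x.2]
      simp only [sphereLinear, ContinuousMap.sub_apply, ContinuousMap.smul_apply,
        ContinuousMap.pow_apply, ContinuousMap.coe_mk, smul_eq_mul, hA]
      generalize ⟪a, (x : 𝔼)⟫ = s
      rcases k with _ | _ | k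
      · simp
      · simp; ring
      · simp only [Nat.add_sub_cancel, show k + 1 + 1 - 2 = k by omega]
        push_cast
        ring
    have h2 : ((k : ℝ) * (k - 1 : ℕ) * ‖a‖ ^ 2) • sphereLinear a ^ (k - 2) ∈
        resolventRange n K := by
      rcases k with _ | k
      · simp
      · exact Submodule.smul_mem _ _ (ih _ (by omega))
    have h3 := Submodule.smul_mem _ A⁻¹ (Submodule.add_mem _ h1 h2)
    rwa [sub_add_cancel, smul_smul, inv_mul_cancel₀ hA0.ne', one_smul] at h3

lemma exp_sphereLinear_mem {K : ℝ} (hK : 0 < K) (a : 𝔼) :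
    NormedSpace.exp (sphereLinear a) ∈ (resolventRange n K).topologicalClosure := by
  have h := NormedSpace.exp_series_hasSum_exp' (𝕂 := ℝ) (sphereLinear a)
  refine (resolventRange n K).isClosed_topologicalClosure.mem_of_tendsto h
    (Eventually.of_forall fun s => Submodule.sum_mem _ fun k _ => Submodule.smul_mem _ _ ?_)
  exact (resolventRange n K).le_topologicalClosure (sphereLinear_pow_mem hK a k)

lemma exp_sphereLinear_apply (a : 𝔼) (x : 𝕊) :
    NormedSpace.exp (sphereLinear a) x = Real.exp ⟪a, (x : 𝔼)⟫ := by
  have h := NormedSpace.map_exp (ContinuousMap.evalAlgHom ℝ ℝ x) (continuous_eval_const x)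
    (sphereLinear a)
  rw [← Real.exp_eq_exp_ℝ] at h
  exact h

lemma resolventRange_dense {K : ℝ} (hK : 0 < K) : (resolventRange n K).topologicalClosure = ⊤ := by
  set s : Set C(sphere (0 : EuclideanSpace ℝ (Fin (n + 1))) 1, ℝ) :=
    Set.range fun a => NormedSpace.exp (sphereLinear a) with hs
  set A := Algebra.adjoin ℝ s with hA
  have hmon : (Submonoid.closure s : Set _) ⊆ s := by
    intro g hg
    induction hg using Submonoid.closure_induction with
    | mem x hx => exact hx
    | one =>
      refine ⟨0, ?_⟩
      ext x
      simp [exp_sphereLinear_apply]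
    | mul x y _ _ hx hy =>
      obtain ⟨a, rfl⟩ := hx
      obtain ⟨b, rfl⟩ := hy
      refine ⟨a + b, ?_⟩
      ext x
      simp [exp_sphereLinear_apply, inner_add_left, Real.exp_add]
  have hle : A.toSubmodule ≤ (resolventRange n K).topologicalClosure := by
    rw [hA, Algebra.adjoin_eq_span, Submodule.span_le]
    intro g hg
    obtain ⟨a, rfl⟩ := hmon hg
    exact exp_sphereLinear_mem hK a
  have hsep : A.SeparatesPoints := by
    intro x y hxy
    refine ⟨_, ⟨NormedSpace.exp (sphereLinear ((x : 𝔼) - y)),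
      Algebra.subset_adjoin ⟨_, rfl⟩, rfl⟩, ?_⟩
    beta_reduce
    rw [exp_sphereLinear_apply, exp_sphereLinear_apply, Real.exp_injective.ne_iff, ← sub_ne_zero,
      ← inner_sub_right, inner_self_ne_zero, sub_ne_zero]
    exact fun h => hxy (Subtype.ext h)
  have htop := ContinuousMap.subalgebra_topologicalClosure_eq_top_of_separatesPoints A hsep
  rw [eq_top_iff]
  intro g _
  have hg : g ∈ A.topologicalClosure := by rw [htop]; trivial
  have hcl := closure_mono (show (A : Set C(𝕊, ℝ)) ⊆
    ((resolventRange n K).topologicalClosure : Set C(𝕊, ℝ)) from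
    fun _ h => hle h)
  rw [(resolventRange n K).isClosed_topologicalClosure.closure_eq] at hcl
  exact hcl hg

/-- Solvability of the resolvent equation in the closure sense. -/
lemma exists_resolves {K : ℝ} (hK : 0 < K) {g : 𝔼 → ℝ} (hg : ContinuousOn g 𝕊) :
    ∃ u : 𝔼 → ℝ, (∀ t : ℝ, 0 < t → ∀ y, y ≠ 0 → u (t • y) = u y) ∧ Resolves K u g := by
  have happ : ∀ ε > 0, ∃ P, IsHomZero P ∧ ∀ x ∈ 𝕊, |K * P x - laplacian P x - g x| ≤ ε := by
    intro ε hε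
    set G : C(sphere (0 : EuclideanSpace ℝ (Fin (n + 1))) 1, ℝ) :=
      ⟨fun x => g x, continuousOn_iff_continuous_domRestrict.1 hg⟩ with hG
    have hmem : G ∈ closure (resolventRange n K : Set _) := by
      have : G ∈ (resolventRange n K).topologicalClosure := by
        rw [resolventRange_dense hK]; trivial
      exact this
    obtain ⟨H, ⟨P, hP, hPH⟩, hd⟩ := Metric.mem_closure_iff.1 hmem ε hε
    refine ⟨P, hP, fun x hx => ?_⟩
    have h1 := (ContinuousMap.dist_apply_le_dist (f := G) (g := H) ⟨x, hx⟩).trans hd.le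
    rw [dist_comm, Real.dist_eq, hPH] at h1
    exact h1
  set e : ℕ → ℝ := fun k => 1 / (k + 1 : ℝ) with he
  have he0 : ∀ k, 0 < e k := fun k => by positivity
  have helim : Tendsto e atTop (𝓝 0) := tendsto_one_div_add_atTop_nhds_zero_nat
  choose P hP hP' using fun k => happ (e k) (he0 k)
  have hdiff : ∀ k l, ∀ x ∈ 𝕊, P k x - P l x ≤ (e k + e l) / K := by
    intro k l x hx
    have := (((hP k).resolves K).linear ((hP l).resolves K) 1 (-1)).le_of_le hK (c := e k + e l)
      (fun y hy => by
        have h1 := abs_le.1 (hP' k y hy)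
        have h2 := abs_le.1 (hP' l y hy)
        linarith) x hx
    linarith
  have habs : ∀ k l, ∀ x ∈ 𝕊, |P k x - P l x| ≤ (e k + e l) / K := by
    intro k l x hx
    have h1 := hdiff k l x hx
    have h2 := hdiff l k x hx
    rw [add_comm] at h2
    exact abs_le.2 ⟨by linarith, by linarith⟩
  have hlim : ∀ x : 𝔼, ∃ c : ℝ, x ∈ 𝕊 → Tendsto (fun k => P k x) atTop (𝓝 c) := by
    intro x
    by_cases hx : x ∈ 𝕊
    · have hb : Tendsto (fun N => (e N + e N) / K) atTop (𝓝 0) := by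
        simpa using (helim.add helim).div_const K
      have hc : CauchySeq fun k => P k x := by
        refine cauchySeq_of_le_tendsto_0 _ (fun k l N hk hl => ?_) hb
        rw [Real.dist_eq]
        refine (habs k l x hx).trans ?_
        have hanti : ∀ {N k}, N ≤ k → e k ≤ e N := fun {N k} h => by
          simp only [he]; gcongr
        gcongr
        · exact hanti hk
        · exact hanti hl
      obtain ⟨c, hc⟩ := cauchySeq_tendsto_of_complete hc
      exact ⟨c, fun _ => hc⟩
    · exact ⟨0, fun h => absurd h hx⟩
  choose U hU using hlim
  refine ⟨fun y => U (‖y‖⁻¹ • y), fun t ht y hy => ?_, fun ε hε => ?_⟩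
  · have h0 := norm_ne_zero_iff.2 hy
    have h1 : ‖t • y‖⁻¹ • t • y = ‖y‖⁻¹ • y := by
      rw [norm_smul, Real.norm_eq_abs, abs_of_pos ht, smul_smul]
      congr 1
      field_simp
    beta_reduce
    rw [h1]
  · have hUb : ∀ k, ∀ x ∈ 𝕊, |P k x - U x| ≤ e k / K := by
      intro k x hx
      have h1 := (tendsto_const_nhds (x := P k x)).sub (hU x hx)
      have h2 : Tendsto (fun l => (e k + e l) / K) atTop (𝓝 ((e k + 0) / K)) :=
        (helim.const_add (e k)).div_const K
      rw [add_zero] at h2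
      exact le_of_tendsto_of_tendsto' h1.abs h2 fun l => habs k l x hx
    have h3 : Tendsto (fun k => e k / K) atTop (𝓝 0) := by simpa using helim.div_const K
    obtain ⟨k, hk1, hk2⟩ := ((h3.eventually (gt_mem_nhds hε)).and
      (helim.eventually (gt_mem_nhds hε))).exists
    refine ⟨P k, hP k, fun x hx => ⟨?_, (hP' k x hx).trans hk2.le⟩⟩
    have : ‖x‖ = 1 := by simpa using hx
    simp only [this, inv_one, one_smul]
    exact (hUb k x hx).trans hk1.le

end Existence

section Nonlinear

open Filter Topology

variable {n : ℕ}

local notation "𝔼" => EuclideanSpace ℝ (Fin (n + 1))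
local notation "𝕊" => sphere (0 : EuclideanSpace ℝ (Fin (n + 1))) 1

lemma rpow_sub_rpow_le {q v w : ℝ} (hq : 1 ≤ q) (hv : 0 < v) (hw : 0 ≤ w) :
    v ^ q - w ^ q ≤ q * v ^ (q - 1) * (v - w) := by
  have h1 := one_add_mul_self_le_rpow_one_add (s := w / v - 1)
    (by have : 0 ≤ w / v := by positivity
        linarith) hq
  rw [add_sub_cancel, Real.div_rpow hw hv.le] at h1
  have hvq : 0 < v ^ q := Real.rpow_pos_of_pos hv q
  have h2 : v ^ (q - 1) = v ^ q / v := by rw [Real.rpow_sub hv, Real.rpow_one]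
  rw [le_div_iff₀ hvq] at h1
  rw [h2]
  have h3 : q * (v ^ q / v) * (v - w) = -(q * (w / v - 1) * v ^ q) := by
    field_simp
    ring
  rw [h3]
  linarith

/-- Solutions of `ΔV + n V = f V ^ (p - 1)` on the sphere by monotone iteration. -/
lemma exists_sphere_solution (hn : 2 ≤ n) {p : ℝ} (hp : 2 < p) {f : 𝔼 → ℝ}
    (hf : ContDiffOn ℝ 1 f {0}ᶜ)
    {m M : ℝ} (hm : 0 < m) (hfm : ∀ x ∈ 𝕊, m ≤ f x) (hfM : ∀ x ∈ 𝕊, f x ≤ M) :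
    ∃ V : 𝔼 → ℝ, IsHomZero V ∧ (∀ x ∈ 𝕊, 0 < V x) ∧
      (∀ x ∈ 𝕊, n / M ≤ V x ^ (p - 2)) ∧ (∀ x ∈ 𝕊, V x ^ (p - 2) ≤ n / m) ∧
      ∀ x ∈ 𝕊, laplacian V x = f x * V x ^ (p - 1) - n * V x := by
  obtain ⟨x₀, hx₀⟩ : (𝕊).Nonempty := NormedSpace.sphere_nonempty.2 zero_le_one
  have hmM : m ≤ M := (hfm x₀ hx₀).trans (hfM x₀ hx₀)
  have hM : 0 < M := hm.trans_le hmM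
  have hn0 : (0 : ℝ) < n := by positivity
  have hp2 : 0 < p - 2 := by linarith
  have hsub : 𝕊 ⊆ {0}ᶜ := fun y hy => ne_zero_of_mem_unitSphere hy
  set c₁ : ℝ := (n / M) ^ (p - 2)⁻¹ with hc₁
  set c₂ : ℝ := (n / m) ^ (p - 2)⁻¹ with hc₂
  have hc₁0 : 0 < c₁ := by positivity
  have hc₁p : c₁ ^ (p - 2) = n / M := Real.rpow_inv_rpow (by positivity) hp2.ne'
  have hc₂p : c₂ ^ (p - 2) = n / m := Real.rpow_inv_rpow (by positivity) hp2.ne'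
  have hc₁₂ : c₁ ≤ c₂ := by
    rw [hc₁, hc₂]; gcongr
  have hpow : ∀ v : ℝ, 0 < v → v ^ (p - 1) = v ^ (p - 2) * v := fun v hv => by
    rw [show p - 1 = p - 2 + 1 by ring, Real.rpow_add_one hv.ne']
  set K : ℝ := (p - 1) * M * n / m with hK
  have hK0 : 0 < K := by
    have : 0 < p - 1 := by linarith
    positivity
  set F : 𝔼 → ℝ → ℝ := fun y v => (K + n) * v - f y * v ^ (p - 1) with hF
  have hF1 : ∀ x ∈ 𝕊, ∀ v w : ℝ, c₁ ≤ w → w ≤ v → v ≤ c₂ → F x w ≤ F x v := by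
    intro x hx v w hw hwv hv
    have hv0 : 0 < v := by linarith
    have h1 := rpow_sub_rpow_le (q := p - 1) (by linarith) hv0 (hc₁0.le.trans hw)
    have h2 : v ^ (p - 2) ≤ n / m := by
      rw [← hc₂p]; gcongr
    have h3 : f x * (v ^ (p - 1) - w ^ (p - 1)) ≤ M * ((p - 1) * (n / m) * (v - w)) := by
      have h0 : 0 ≤ v ^ (p - 1) - w ^ (p - 1) := sub_nonneg.2
        (Real.rpow_le_rpow (hc₁0.le.trans hw) hwv (by linarith))
      refine mul_le_mul (hfM x hx) (h1.trans ?_) h0 hM.le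
      rw [show p - 1 - 1 = p - 2 by ring]
      have : 0 ≤ p - 1 := by linarith
      have : 0 ≤ v - w := by linarith
      gcongr
    have h4 : M * ((p - 1) * (n / m) * (v - w)) = K * (v - w) := by rw [hK]; ring
    have h5 : 0 ≤ (n : ℝ) * (v - w) := by
      have : 0 ≤ v - w := by linarith
      positivity
    simp only [hF]
    nlinarith
  have hF2 : ∀ x ∈ 𝕊, ∀ v w : ℝ, c₁ ≤ w → w ≤ v → v ≤ c₂ → F x v - F x w ≤ (K + n) * (v - w) := by
    intro x hx v w hw hwv hv
    have h0 : 0 ≤ v ^ (p - 1) - w ^ (p - 1) := sub_nonneg.2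
      (Real.rpow_le_rpow (hc₁0.le.trans hw) hwv (by linarith))
    have := mul_nonneg (hm.le.trans (hfm x hx)) h0
    simp only [hF]
    linarith
  have hFc₂ : ∀ x ∈ 𝕊, F x c₂ ≤ K * c₂ := by
    intro x hx
    have h1 : (n : ℝ) ≤ f x * (n / m) := by
      calc (n : ℝ) = m * (n / m) := by field_simp
        _ ≤ _ := by gcongr; exact hfm x hx
    simp only [hF]
    rw [hpow _ (hc₁0.trans_le hc₁₂), hc₂p]
    nlinarith
  have hFc₁ : ∀ x ∈ 𝕊, K * c₁ ≤ F x c₁ := by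
    intro x hx
    have h1 : f x * (n / M) ≤ n := by
      calc f x * (n / M) ≤ M * (n / M) := by gcongr; exact hfM x hx
        _ = _ := by field_simp
    simp only [hF]
    rw [hpow _ hc₁0, hc₁p]
    nlinarith
  have hFcont : ∀ w : 𝔼 → ℝ, ContinuousOn w 𝕊 → ContinuousOn (fun y => F y (w y)) 𝕊 :=
    fun w hw => (continuousOn_const.mul hw).sub ((hf.continuousOn.mono hsub).mul
      (hw.rpow_const fun _ _ => Or.inr (by linarith)))
  have hsolve : ∀ w : 𝔼 → ℝ, ∃ u : 𝔼 → ℝ, ContinuousOn w 𝕊 →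
      (∀ t : ℝ, 0 < t → ∀ y, y ≠ 0 → u (t • y) = u y) ∧ Resolves K u fun y => F y (w y) := by
    intro w
    by_cases hw : ContinuousOn w 𝕊
    · obtain ⟨u, hu⟩ := exists_resolves hK0 (hFcont w hw)
      exact ⟨u, fun _ => hu⟩
    · exact ⟨0, fun h => absurd h hw⟩
  choose T hT using hsolve
  set u : ℕ → 𝔼 → ℝ := fun k => T^[k] fun _ => c₂ with hu
  have hus : ∀ k, u (k + 1) = T (u k) := fun k => Function.iterate_succ_apply' T k _
  have hcont : ∀ k, ContinuousOn (u k) 𝕊 := by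
    intro k
    induction k with
    | zero => exact continuousOn_const
    | succ k ih =>
      rw [hus]
      exact ((hT _ ih).2.contDiffOn_one hn hK0 (hT _ ih).1).continuousOn.mono hsub
  have hres : ∀ k, Resolves K (u (k + 1)) fun y => F y (u k y) := fun k => by
    rw [hus]
    exact (hT _ (hcont k)).2
  have hbd : ∀ k, ∀ x ∈ 𝕊, c₁ ≤ u k x ∧ u (k + 1) x ≤ u k x ∧ u k x ≤ c₂ := by
    intro k
    induction k with
    | zero =>
      intro x hx
      exact ⟨hc₁₂, (hres 0).mono hK0 (resolves_const K c₂) hFc₂ x hx, le_rfl⟩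
    | succ k ih =>
      have hlow : ∀ x ∈ 𝕊, c₁ ≤ u (k + 1) x := (resolves_const K c₁).mono hK0 (hres k)
        fun y hy => (hFc₁ y hy).trans (hF1 y hy _ _ le_rfl (ih y hy).1 (ih y hy).2.2)
      intro x hx
      refine ⟨hlow x hx, (hres (k + 1)).mono hK0 (hres k) (fun y hy => ?_) x hx,
        (ih x hx).2.1.trans (ih x hx).2.2⟩
      exact hF1 y hy _ _ (hlow y hy) (ih y hy).2.1 (ih y hy).2.2
  have hanti : ∀ x ∈ 𝕊, Antitone fun k => u k x := fun x hx =>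
    antitone_nat_of_succ_le fun k => (hbd k x hx).2.1
  have hlim : ∀ x : 𝔼, ∃ c : ℝ, x ∈ 𝕊 → Tendsto (fun k => u k x) atTop (𝓝 c) := fun x =>
    ⟨⨅ k, u k x, fun hx => tendsto_atTop_ciInf (hanti x hx)
      ⟨c₁, by rintro _ ⟨k, rfl⟩; exact (hbd k x hx).1⟩⟩
  choose U hU using hlim
  set B : ℝ := (K + n) * c₂ + K * c₁ with hB
  have hLip : ∀ x ∈ 𝕊, ∀ y ∈ 𝕊, |U x - U y| ≤ 17 / 8 * B * ‖x - y‖ := by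
    intro x hx y hy
    have h1 := ((hU x hx).sub (hU y hy)).abs
    rw [← tendsto_add_atTop_iff_nat 1] at h1
    refine le_of_tendsto' h1 fun k => (hres k).lipschitz hn hK0 (fun z hz => ?_) hx hy
    obtain ⟨h1, -, h3⟩ := hbd k z hz
    have h4 := hF1 z hz _ _ h1 h3 le_rfl
    have h5 := hF1 z hz _ _ le_rfl h1 h3
    have h6 := hFc₁ z hz
    have h7 := hFc₂ z hz
    have h8 : 0 ≤ (n : ℝ) * c₂ := by positivity
    have h9 : 0 ≤ K * c₁ := by positivity
    have h10 : 0 ≤ K * c₂ := by positivity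
    rw [abs_le]
    constructor <;> rw [hB] <;> nlinarith
  have hUcont : ContinuousOn U 𝕊 := by
    have : LipschitzOnWith (17 / 8 * B).toNNReal U 𝕊 :=
      LipschitzOnWith.of_dist_le_mul fun x hx y hy => by
        rw [Real.dist_eq, dist_eq_norm]
        refine (hLip x hx y hy).trans ?_
        gcongr
        exact Real.le_coe_toNNReal _
    exact this.continuousOn
  have hunif : TendstoUniformlyOn u U atTop 𝕊 :=
    Antitone.tendstoUniformlyOn_of_forall_tendsto (isCompact_sphere _ _) hcont
      hanti hUcont hU
  have hUb : ∀ x ∈ 𝕊, c₁ ≤ U x ∧ U x ≤ c₂ := fun x hx =>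
    ⟨ge_of_tendsto' (hU x hx) fun k => (hbd k x hx).1,
      le_of_tendsto' (hU x hx) fun k => (hbd k x hx).2.2⟩
  have hUle : ∀ k, ∀ x ∈ 𝕊, U x ≤ u k x := fun k x hx => (hanti x hx).le_of_tendsto (hU x hx) k
  set V : 𝔼 → ℝ := fun y => U (‖y‖⁻¹ • y) with hV
  have hVU : ∀ x ∈ 𝕊, V x = U x := by
    intro x hx
    have : ‖x‖ = 1 := by simpa using hx
    simp [hV, this]
  have hVhom : ∀ t : ℝ, 0 < t → ∀ y, y ≠ 0 → V (t • y) = V y := by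
    intro t ht y hy
    have h0 := norm_ne_zero_iff.2 hy
    have h1 : ‖t • y‖⁻¹ • t • y = ‖y‖⁻¹ • y := by
      rw [norm_smul, Real.norm_eq_abs, abs_of_pos ht, smul_smul]
      congr 1
      field_simp
    simp only [hV]
    rw [h1]
  have hVres : Resolves K V fun y => F y (V y) := by
    refine resolves_of_approx fun ε hε => ?_
    have hε' : 0 < ε / (K + n) := by positivity
    rw [Metric.tendstoUniformlyOn_iff] at hunif
    obtain ⟨k, hk1, hk2⟩ := ((((tendsto_add_atTop_nat 1).eventually (hunif ε hε))).and
      (hunif _ hε')).exists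
    refine ⟨_, _, hres k, fun x hx => ⟨?_, ?_⟩⟩
    · have := hk1 x hx
      rw [dist_comm, Real.dist_eq] at this
      rw [hVU x hx]
      exact this.le
    · have h2 := hk2 x hx
      have h3 := hUle k x hx
      rw [dist_comm, Real.dist_eq, abs_of_nonneg (by linarith), lt_div_iff₀ (by positivity)] at h2
      rw [hVU x hx, abs_of_nonneg
        (sub_nonneg.2 (hF1 x hx _ _ (hUb x hx).1 h3 (hbd k x hx).2.2))]
      have := hF2 x hx _ _ (hUb x hx).1 h3 (hbd k x hx).2.2
      linarith
  have hVpos : ∀ y, y ≠ 0 → 0 < V y := fun y hy =>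
    hc₁0.trans_le (hUb _ (unit_mem_sphere hy)).1
  have hV1 := hVres.contDiffOn_one hn hK0 hVhom
  have hFV : ContDiffOn ℝ 1 (fun y => F y (V y)) {0}ᶜ :=
    (contDiffOn_const.mul hV1).sub (hf.mul (hV1.rpow_const_of_ne fun y hy => (hVpos y hy).ne'))
  have hVz : IsHomZero V := ⟨hVres.contDiffOn_two hn hK0 hVhom hFV, hVhom⟩
  refine ⟨V, hVz, fun x hx => hVpos x (ne_zero_of_mem_unitSphere hx), fun x hx => ?_,
    fun x hx => ?_, fun x hx => ?_⟩
  · rw [hVU x hx, ← hc₁p]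
    exact Real.rpow_le_rpow hc₁0.le (hUb x hx).1 hp2.le
  · rw [hVU x hx, ← hc₂p]
    exact Real.rpow_le_rpow (hc₁0.le.trans (hUb x hx).1) (hUb x hx).2 hp2.le
  · rw [hVres.laplacian_eq hK0 hVz (hFV.continuousOn.mono hsub) x hx]
    simp only [hF]
    ring

end Nonlinear

section Estimates

open Filter Topology

variable {n : ℕ}

local notation "𝔼" => EuclideanSpace ℝ (Fin (n + 1))
local notation "𝕊" => sphere (0 : EuclideanSpace ℝ (Fin (n + 1))) 1

/-- Comparison of solutions of `ΔV + n V = f V ^ (p - 1)` on the sphere. -/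
lemma solution_comparison {p : ℝ} (hp : 2 < p) {V W f g : 𝔼 → ℝ} (hV : IsHomZero V)
    (hW : IsHomZero W) (hV0 : ∀ x ∈ 𝕊, 0 < V x) (hW0 : ∀ x ∈ 𝕊, 0 < W x)
    (hVf : ∀ x ∈ 𝕊, laplacian V x = f x * V x ^ (p - 1) - n * V x)
    (hWg : ∀ x ∈ 𝕊, laplacian W x = g x * W x ^ (p - 1) - n * W x)
    (hf : ∀ x ∈ 𝕊, 0 < f x) {κ : ℝ} (hgf : ∀ x ∈ 𝕊, g x ≤ κ * f x) :
    ∀ x ∈ 𝕊, V x ^ (p - 2) ≤ κ * W x ^ (p - 2) := by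
  intro x hx
  have hsub : 𝕊 ⊆ {0}ᶜ := fun y hy => ne_zero_of_mem_unitSphere hy
  obtain ⟨x₀, hx₀, hmax⟩ := (isCompact_sphere (0 : 𝔼) 1).exists_isMaxOn ⟨x, hx⟩
    ((hV.contDiffOn.continuousOn.mono hsub).div (hW.contDiffOn.continuousOn.mono hsub)
      fun y hy => (hW0 y hy).ne')
  have hne := ne_zero_of_mem_unitSphere hx₀
  set ρ : ℝ := V x₀ / W x₀ with hρ
  have hρ0 : 0 < ρ := div_pos (hV0 _ hx₀) (hW0 _ hx₀)
  have hle : ∀ y ∈ 𝕊, V y ≤ ρ * W y := fun y hy => by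
    have : V y / W y ≤ ρ := hmax hy
    rwa [div_le_iff₀ (hW0 y hy)] at this
  have heq : V x₀ = ρ * W x₀ := by
    rw [hρ, div_mul_cancel₀ _ (hW0 _ hx₀).ne']
  have hP := hV.linear hW 1 (-ρ)
  have hloc : IsLocalMax (fun y => 1 * V y + -ρ * W y) x₀ := by
    filter_upwards [isOpen_compl_singleton.mem_nhds hne] with y hy
    rw [← eq_unit_of_hom (P := fun y => 1 * V y + -ρ * W y) hP.hom hy, heq]
    have := hle _ (unit_mem_sphere hy)
    beta_reduce
    linarith
  have h1 := laplacian_nonpos_of_isLocalMax (hP.contDiffAt hne) hloc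
  rw [laplacian_linear (hV.contDiffAt hne) (hW.contDiffAt hne), hVf _ hx₀, hWg _ hx₀] at h1
  have hpow : ∀ v : ℝ, 0 < v → v ^ (p - 1) = v ^ (p - 2) * v := fun v hv => by
    rw [show p - 1 = p - 2 + 1 by ring, Real.rpow_add_one hv.ne']
  have hV0' := hV0 _ hx₀
  have hW0' := hW0 _ hx₀
  rw [hpow _ hV0', hpow _ hW0'] at h1
  have h2 : f x₀ * V x₀ ^ (p - 2) ≤ g x₀ * W x₀ ^ (p - 2) := by
    have h3 : (f x₀ * V x₀ ^ (p - 2)) * V x₀ ≤ (g x₀ * W x₀ ^ (p - 2)) * V x₀ := by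
      linear_combination h1 + (n - g x₀ * W x₀ ^ (p - 2)) * heq
    exact le_of_mul_le_mul_right h3 hV0'
  have hρκ : ρ ^ (p - 2) ≤ κ := by
    have hWp : 0 < W x₀ ^ (p - 2) := Real.rpow_pos_of_pos hW0' _
    have h4 : f x₀ * V x₀ ^ (p - 2) ≤ κ * f x₀ * W x₀ ^ (p - 2) :=
      h2.trans (mul_le_mul_of_nonneg_right (hgf _ hx₀) hWp.le)
    rw [hρ, Real.div_rpow hV0'.le hW0'.le, div_le_iff₀ hWp]
    refine le_of_mul_le_mul_left (a := f x₀) ?_ (hf _ hx₀)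
    linarith
  calc V x ^ (p - 2) ≤ (ρ * W x) ^ (p - 2) :=
        Real.rpow_le_rpow (hV0 x hx).le (hle x hx) (by linarith)
    _ = ρ ^ (p - 2) * W x ^ (p - 2) := Real.mul_rpow hρ0.le (hW0 x hx).le
    _ ≤ _ := mul_le_mul_of_nonneg_right hρκ (Real.rpow_pos_of_pos (hW0 x hx) _).le

lemma numeric_bound {ζ : ℝ} {n : ℕ} (hn : 2 ≤ n) (h0 : 0 ≤ ζ) (h1 : ζ ≤ 1 / 3) :
    17 / 16 * (17 / 16 * ζ * ζ + 37 / 18 * (ζ / Real.pi) * (1 + ζ / n)) ≤ 1 / 2 := by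
  have hn' : (2 : ℝ) ≤ n := by exact_mod_cast hn
  have h2 : ζ / Real.pi ≤ 1 / 9 := by
    rw [div_le_iff₀ Real.pi_pos]
    linarith [Real.pi_gt_three]
  have h3 : ζ / n ≤ 1 / 6 := by
    rw [div_le_iff₀ (by positivity)]
    linarith
  have h4 : ζ * ζ ≤ 1 / 9 := by nlinarith
  have h5 : 0 ≤ ζ / Real.pi := by positivity
  have h6 : 0 ≤ ζ / n := by positivity
  have h7 : (ζ / Real.pi) * (1 + ζ / n) ≤ 1 / 9 * (7 / 6) := by
    apply mul_le_mul h2 (by linarith) (by positivity) (by norm_num)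
  linarith

/-- Second-difference estimate for solutions with almost constant right-hand side. -/
lemma second_difference_le (hn : 2 ≤ n) {p : ℝ} (hp : 2 < p) {f V : 𝔼 → ℝ} (hV : IsHomZero V)
    (hV0 : ∀ x ∈ 𝕊, 0 < V x)
    (hVf : ∀ x ∈ 𝕊, laplacian V x = f x * V x ^ (p - 1) - n * V x)
    {m M G : ℝ} (hm : 0 < m) (hG : 0 ≤ G) (hfm : ∀ x ∈ 𝕊, m ≤ f x) (hfM : ∀ x ∈ 𝕊, f x ≤ M)
    (hMG : M ≤ m + Real.pi * G) (hV1 : ∀ x ∈ 𝕊, n / M ≤ V x ^ (p - 2))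
    (hV2 : ∀ x ∈ 𝕊, V x ^ (p - 2) ≤ n / m) (hζ : Real.pi * n * (G / m) ≤ 1 / 3) :
    ∃ L : ℝ, (∀ x ∈ 𝕊, L ≤ V x) ∧ 0 ≤ L ∧ ∀ (R : 𝔼 ≃ₗᵢ[ℝ] 𝔼) (τ : ℝ), 0 ≤ τ → τ ≤ 1 →
      (∀ x ∈ 𝕊, ‖R x - x‖ ≤ τ) → (∀ x ∈ 𝕊, |f (R x) - f x| ≤ G * τ) →
      ∀ x ∈ 𝕊, ∀ y ∈ 𝕊, (V (R x) - V x) - (V (R y) - V y) ≤ L * τ * ‖x - y‖ := by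
  obtain ⟨x₀, hx₀⟩ : (𝕊).Nonempty := NormedSpace.sphere_nonempty.2 zero_le_one
  have hM : 0 < M := hm.trans_le ((hfm x₀ hx₀).trans (hfM x₀ hx₀))
  have hn0 : (2 : ℝ) ≤ n := by exact_mod_cast hn
  have hpi := Real.pi_gt_three
  set δ : ℝ := G / m with hδ
  have hδ0 : 0 ≤ δ := by positivity
  have hGδ : G = δ * m := by rw [hδ]; field_simp
  set ζ : ℝ := Real.pi * n * δ with hζdef
  have hζ0 : 0 ≤ ζ := by positivity
  have hδ18 : δ ≤ 1 / 18 := by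
    have h1 : (3 : ℝ) * 2 ≤ Real.pi * n := by gcongr
    have h2 := mul_le_mul_of_nonneg_right h1 hδ0
    linarith
  have hpow : ∀ v : ℝ, 0 < v → v ^ (p - 1) = v ^ (p - 2) * v := fun v hv => by
    rw [show p - 1 = p - 2 + 1 by ring, Real.rpow_add_one hv.ne']
  have hsub : 𝕊 ⊆ {0}ᶜ := fun y hy => ne_zero_of_mem_unitSphere hy
  obtain ⟨x₁, hx₁, hmax⟩ := (isCompact_sphere (0 : 𝔼) 1).exists_isMaxOn ⟨x₀, hx₀⟩
    (hV.contDiffOn.continuousOn.mono hsub)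
  set W : ℝ := V x₁ with hW
  have hW0 : 0 < W := hV0 _ hx₁
  have hVW : ∀ x ∈ 𝕊, V x ≤ W := fun x hx => hmax hx
  set φ : 𝔼 → ℝ := fun x => f x * V x ^ (p - 2) with hφ
  have hfpos : ∀ x ∈ 𝕊, 0 < f x := fun x hx => hm.trans_le (hfm x hx)
  have hφ0 : ∀ x ∈ 𝕊, 0 < φ x := fun x hx =>
    mul_pos (hfpos x hx) (Real.rpow_pos_of_pos (hV0 x hx) _)
  have hφup : ∀ x ∈ 𝕊, φ x ≤ n + ζ := by
    intro x hx
    calc φ x ≤ M * (n / m) := mul_le_mul (hfM x hx) (hV2 x hx)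
          (Real.rpow_pos_of_pos (hV0 x hx) _).le hM.le
      _ ≤ (m + Real.pi * G) * (n / m) := by gcongr
      _ = n + ζ := by rw [hζdef, hδ]; field_simp
  have hφlow : ∀ x ∈ 𝕊, n - ζ ≤ φ x := by
    intro x hx
    have h1 : m * (n / M) ≤ φ x := mul_le_mul (hfm x hx) (hV1 x hx) (by positivity)
      (hfpos x hx).le
    refine le_trans ?_ h1
    rw [← mul_div_assoc, le_div_iff₀ hM]
    have h2 : (0 : ℝ) ≤ n - ζ := by linarith
    calc (n - ζ) * M ≤ (n - ζ) * (m + Real.pi * G) := by gcongr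
      _ = m * n - m * n * (Real.pi * δ) ^ 2 := by rw [hζdef, hGδ]; ring
      _ ≤ m * n := by
        have : 0 ≤ m * n * (Real.pi * δ) ^ 2 := by positivity
        linarith
  have hφabs : ∀ x ∈ 𝕊, |φ x - n| ≤ ζ := fun x hx =>
    abs_le.2 ⟨by linarith [hφlow x hx], by linarith [hφup x hx]⟩
  have hlap : ∀ x ∈ 𝕊, laplacian V x = V x * (φ x - n) := by
    intro x hx
    rw [hVf x hx, hpow _ (hV0 x hx)]
    ring
  have hlapW : ∀ x ∈ 𝕊, |laplacian V x| ≤ W * ζ := by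
    intro x hx
    rw [hlap x hx, abs_mul, abs_of_pos (hV0 x hx)]
    exact mul_le_mul (hVW x hx) (hφabs x hx) (abs_nonneg _) hW0.le
  refine ⟨W / 2, fun x hx => ?_, by positivity, ?_⟩
  · have := two_point_oscillation hn hV hlapW hx₁ hx
    nlinarith
  intro R τ hτ0 hτ1 hRτ hfR
  have hRS : ∀ x ∈ 𝕊, R x ∈ 𝕊 := fun x hx => by simpa using hx
  have hRS' : ∀ x ∈ 𝕊, R.symm x ∈ 𝕊 := fun x hx => by simpa using hx
  have hκ : ∀ x ∈ 𝕊, f (R x) ≤ (1 + δ * τ) * f x := by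
    intro x hx
    have h1 := (abs_le.1 (hfR x hx)).2
    have h2 := mul_le_mul_of_nonneg_left (hfm x hx) (mul_nonneg hδ0 hτ0)
    rw [hGδ] at h1
    linarith
  have hκ' : ∀ x ∈ 𝕊, f (R.symm x) ≤ (1 + δ * τ) * f x := by
    intro x hx
    have h1 := (abs_le.1 (hfR _ (hRS' x hx))).1
    rw [R.apply_symm_apply] at h1
    have h2 := mul_le_mul_of_nonneg_left (hfm x hx) (mul_nonneg hδ0 hτ0)
    rw [hGδ] at h1
    linarith
  have hcomp : ∀ (S : 𝔼 ≃ₗᵢ[ℝ] 𝔼), (∀ x ∈ 𝕊, f x ≤ (1 + δ * τ) * f (S x)) → ∀ x ∈ 𝕊,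
      V (S x) ^ (p - 2) ≤ (1 + δ * τ) * V x ^ (p - 2) := by
    intro S hS
    have hSS : ∀ x ∈ 𝕊, S x ∈ 𝕊 := fun x hx => by simpa using hx
    refine solution_comparison (n := n) (V := fun x => V (S x)) (f := fun x => f (S x)) (g := f)
      hp (hV.comp_isometry S) hV (fun x hx => hV0 _ (hSS x hx)) hV0 (fun x hx => ?_) hVf
      (fun x hx => hfpos _ (hSS x hx)) hS
    rw [laplacian_comp_isometry S (hV.contDiffAt (hsub (hSS x hx))), hVf _ (hSS x hx)]
  have hV₁ : ∀ x ∈ 𝕊, V (R x) ^ (p - 2) ≤ (1 + δ * τ) * V x ^ (p - 2) :=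
    hcomp R fun x hx => by simpa using hκ' _ (hRS x hx)
  have hV₂ : ∀ x ∈ 𝕊, V x ^ (p - 2) ≤ (1 + δ * τ) * V (R x) ^ (p - 2) := fun x hx => by
    have := hcomp R.symm (fun x hx => by simpa using hκ _ (hRS' x hx)) _ (hRS x hx)
    simpa using this
  have hδτ0 : 0 ≤ δ * τ := mul_nonneg hδ0 hτ0
  have hδτ : δ * τ ≤ 1 / 18 := by nlinarith
  have hφ₁ : ∀ x ∈ 𝕊, φ (R x) ≤ (1 + δ * τ) ^ 2 * φ x := by
    intro x hx
    calc φ (R x) ≤ ((1 + δ * τ) * f x) * ((1 + δ * τ) * V x ^ (p - 2)) :=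
          mul_le_mul (hκ x hx) (hV₁ x hx) (Real.rpow_pos_of_pos (hV0 _ (hRS x hx)) _).le
            (mul_nonneg (by linarith) (hfpos x hx).le)
      _ = _ := by simp only [hφ]; ring
  have hφ₂ : ∀ x ∈ 𝕊, φ x ≤ (1 + δ * τ) ^ 2 * φ (R x) := by
    intro x hx
    have h1 := hκ' _ (hRS x hx)
    rw [R.symm_apply_apply] at h1
    calc φ x ≤ ((1 + δ * τ) * f (R x)) * ((1 + δ * τ) * V (R x) ^ (p - 2)) :=
          mul_le_mul h1 (hV₂ x hx) (Real.rpow_pos_of_pos (hV0 _ hx) _).le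
            (mul_nonneg (by linarith) (hfpos _ (hRS x hx)).le)
      _ = _ := by simp only [hφ]; ring
  have hφR : ∀ x ∈ 𝕊, |φ (R x) - φ x| ≤ 37 / 18 * (δ * τ) * (n + ζ) := by
    intro x hx
    have h1 := hφ₁ x hx
    have h2 := hφ₂ x hx
    have h3 := hφup x hx
    have h4 := hφup _ (hRS x hx)
    have h5 := hφ0 x hx
    have h6 := hφ0 _ (hRS x hx)
    have h7 : (1 + δ * τ) ^ 2 - 1 ≤ 37 / 18 * (δ * τ) := by nlinarith
    have h8 : 0 ≤ 37 / 18 * (δ * τ) := by linarith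
    have h9 := mul_le_mul h7 h3 h5.le h8
    have h10 := mul_le_mul h7 h4 h6.le h8
    rw [abs_le]
    constructor <;> linarith
  have hVR : ∀ x ∈ 𝕊, |V (R x) - V x| ≤ 17 / 16 * (W * ζ) * τ := by
    intro x hx
    have h0 : 0 ≤ 17 / 16 * (W * ζ) := by positivity
    have h1 := two_point_lipschitz hn hV hlapW (hRS x hx) hx
    have h2 := two_point_lipschitz hn hV hlapW hx (hRS x hx)
    rw [norm_sub_rev] at h2
    have h3 := mul_le_mul_of_nonneg_left (hRτ x hx) h0
    rw [abs_le]
    constructor <;> linarith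
  set q : ℝ := W * (17 / 16 * ζ * ζ + 37 / 18 * (ζ / Real.pi) * (1 + ζ / n)) with hq
  have hRz := hV.comp_isometry R
  have hz := hRz.linear hV 1 (-1)
  have hlapq : ∀ x ∈ 𝕊, |laplacian (fun y => 1 * V (R y) + -1 * V y) x| ≤ q * τ := by
    intro x hx
    have hne := hsub hx
    rw [laplacian_linear (hRz.contDiffAt hne) (hV.contDiffAt hne),
      laplacian_comp_isometry R (hV.contDiffAt (hsub (hRS x hx))), hlap x hx, hlap _ (hRS x hx)]
    have h1 : 1 * (V (R x) * (φ (R x) - n)) + -1 * (V x * (φ x - n)) =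
        (V (R x) - V x) * (φ (R x) - n) + V x * (φ (R x) - φ x) := by ring
    rw [h1]
    refine (abs_add_le _ _).trans ?_
    rw [abs_mul, abs_mul, abs_of_pos (hV0 x hx)]
    have h2 : |V (R x) - V x| * |φ (R x) - n| ≤ 17 / 16 * (W * ζ) * τ * ζ :=
      mul_le_mul (hVR x hx) (hφabs _ (hRS x hx)) (abs_nonneg _) (by positivity)
    have h3 : V x * |φ (R x) - φ x| ≤ W * (37 / 18 * (δ * τ) * (n + ζ)) :=
      mul_le_mul (hVW x hx) (hφR x hx) (abs_nonneg _) hW0.le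
    have h4 : 17 / 16 * (W * ζ) * τ * ζ + W * (37 / 18 * (δ * τ) * (n + ζ)) = q * τ := by
      have : ζ / Real.pi * (1 + ζ / n) = δ * (n + ζ) := by
        rw [hζdef]
        field_simp
      rw [hq]
      linear_combination -37 / 18 * W * τ * this
    linarith
  intro x hx y hy
  have h1 := two_point_lipschitz hn hz hlapq hx hy
  have h2 : 17 / 16 * q ≤ W / 2 := by
    have := mul_le_mul_of_nonneg_left (numeric_bound hn hζ0 hζ) hW0.le
    rw [hq]
    linarith
  have h3 := mul_le_mul_of_nonneg_right h2 (mul_nonneg hτ0 (norm_nonneg (x - y)))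
  linarith

end Estimates

section Convexity

open Filter Topology

variable {n : ℕ}

local notation "𝔼" => EuclideanSpace ℝ (Fin (n + 1))
local notation "𝕊" => sphere (0 : EuclideanSpace ℝ (Fin (n + 1))) 1

/-- Great circles. -/
noncomputable def greatCircle (a b : EuclideanSpace ℝ (Fin (n + 1))) (s : ℝ) :
    EuclideanSpace ℝ (Fin (n + 1)) :=
  Real.cos s • a + Real.sin s • b

lemma rotMap_greatCircle {a b : 𝔼} (ha : ‖a‖ = 1) (hb : ‖b‖ = 1) (hab : ⟪a, b⟫ = 0) (t s : ℝ) :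
    rotMap a b t (greatCircle a b s) = greatCircle a b (s + t) := by
  have hba : ⟪b, a⟫ = 0 := by rw [real_inner_comm, hab]
  have h1 : ⟪a, greatCircle a b s⟫ = Real.cos s := by
    simp [greatCircle, inner_add_right, inner_smul_right, ha, hab]
  have h2 : ⟪b, greatCircle a b s⟫ = Real.sin s := by
    simp [greatCircle, inner_add_right, inner_smul_right, hb, hba]
  rw [rotMap_eq, h1, h2]
  simp only [greatCircle, Real.cos_add, Real.sin_add]
  module

lemma greatCircle_zero (a b : 𝔼) : greatCircle a b 0 = a := by simp [greatCircle]

lemma greatCircle_mem {a b : 𝔼} (ha : ‖a‖ = 1) (hb : ‖b‖ = 1) (hab : ⟪a, b⟫ = 0) (s : ℝ) :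
    greatCircle a b s ∈ 𝕊 := by
  have h := rotMap_greatCircle ha hb hab s 0
  rw [greatCircle_zero, zero_add] at h
  rw [← h, mem_sphere_zero_iff_norm, norm_rotMap ha hb hab, ha]

lemma hasDerivAt_greatCircle (a b : 𝔼) (s : ℝ) :
    HasDerivAt (greatCircle a b) (-Real.sin s • a + Real.cos s • b) s :=
  ((Real.hasDerivAt_cos s).smul_const a).add ((Real.hasDerivAt_sin s).smul_const b)

lemma contDiff_greatCircle (a b : 𝔼) {k : WithTop ℕ∞} : ContDiff ℝ k (greatCircle a b) :=
  (Real.contDiff_cos.smul contDiff_const).add (Real.contDiff_sin.smul contDiff_const)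

lemma exists_greatCircle (hn : 1 ≤ n) {a y : 𝔼} (ha : a ∈ 𝕊) (hy : y ∈ 𝕊) :
    ∃ b : 𝔼, ‖b‖ = 1 ∧ ⟪a, b⟫ = 0 ∧ ∃ s ∈ Icc 0 Real.pi, y = greatCircle a b s := by
  rw [mem_sphere_zero_iff_norm] at ha hy
  set c : ℝ := ⟪a, y⟫ with hc
  have hc1 : |c| ≤ 1 := by
    have := abs_real_inner_le_norm a y
    rwa [ha, hy, one_mul] at this
  obtain ⟨hcl, hcu⟩ := abs_le.1 hc1
  have hw : ‖y - c • a‖ ^ 2 = 1 - c ^ 2 := by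
    rw [norm_sub_sq_real, inner_smul_right, real_inner_comm, ← hc, norm_smul, mul_pow, ha, hy,
      Real.norm_eq_abs, sq_abs]
    ring
  have hsin : Real.sin (Real.arccos c) = ‖y - c • a‖ := by
    rw [Real.sin_arccos, ← hw, Real.sqrt_sq (norm_nonneg _)]
  by_cases h0 : y - c • a = 0
  · have hfin : 0 < Module.finrank ℝ (ℝ ∙ a)ᗮ := by
      have : Fact (Module.finrank ℝ 𝔼 = n + 1) := ⟨by simp⟩
      rw [Submodule.finrank_orthogonal_span_singleton (n := n)
        (by rintro rfl; simp at ha)]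
      omega
    have := Module.nontrivial_of_finrank_pos hfin
    obtain ⟨⟨w, hw⟩, hw0⟩ := exists_ne (0 : (ℝ ∙ a)ᗮ)
    have hw0' : w ≠ 0 := fun h => hw0 (Subtype.ext h)
    refine ⟨‖w‖⁻¹ • w, by simp [norm_smul, hw0'], ?_, Real.arccos c,
      ⟨Real.arccos_nonneg _, Real.arccos_le_pi _⟩, ?_⟩
    · rw [inner_smul_right, Submodule.mem_orthogonal_singleton_iff_inner_right.1 hw, mul_zero]
    · rw [greatCircle, hsin, Real.cos_arccos hcl hcu, h0, norm_zero, zero_smul, add_zero]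
      exact sub_eq_zero.1 h0
  · have h0' := norm_ne_zero_iff.2 h0
    refine ⟨‖y - c • a‖⁻¹ • (y - c • a), by simp [norm_smul, h0'], ?_, Real.arccos c,
      ⟨Real.arccos_nonneg _, Real.arccos_le_pi _⟩, ?_⟩
    · rw [inner_smul_right, inner_sub_right, inner_smul_right, real_inner_self_eq_norm_sq, ha,
        ← hc]
      ring
    · rw [greatCircle, hsin, Real.cos_arccos hcl hcu, smul_smul, mul_inv_cancel₀ h0', one_smul]
      abel

/-- Sturm-type comparison with trigonometric functions. -/
lemma sturm_comparison {h : ℝ → ℝ} (hh : ContDiff ℝ 2 h) {L : ℝ} (hL : ∀ s, L ≤ h s)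
    (hL' : ∀ s, -L ≤ deriv (deriv h) s) {s : ℝ} (hs : s ∈ Icc 0 Real.pi) :
    h 0 * Real.cos s + deriv h 0 * Real.sin s ≤ h s := by
  have h1 : ∀ r, HasDerivAt h (deriv h r) r := fun r =>
    (hh.differentiable (by norm_num) r).hasDerivAt
  have h2 : ∀ r, HasDerivAt (deriv h) (deriv (deriv h) r) r := fun r =>
    ((((contDiff_succ_iff_deriv (n := 1)).1 hh).2.2.differentiable (by norm_num)) r).hasDerivAt
  have hE : ∀ r, HasDerivAt (fun r => h r * Real.cos (s - r) + deriv h r * Real.sin (s - r))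
      ((h r + deriv (deriv h) r) * Real.sin (s - r)) r := by
    intro r
    have h3 : HasDerivAt (fun r => s - r) (-1) r := by simpa using (hasDerivAt_id r).const_sub s
    have := ((h1 r).mul h3.cos).add ((h2 r).mul h3.sin)
    refine this.congr_deriv ?_
    ring
  have hmono : MonotoneOn (fun r => h r * Real.cos (s - r) + deriv h r * Real.sin (s - r))
      (Icc 0 s) := by
    refine monotoneOn_of_deriv_nonneg (convex_Icc _ _)
      (fun r _ => (hE r).continuousAt.continuousWithinAt)
      (fun r _ => (hE r).differentiableAt.differentiableWithinAt) fun r hr => ?_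
    rw [interior_Icc] at hr
    rw [(hE r).deriv]
    exact mul_nonneg (by linarith [hL r, hL' r])
      (Real.sin_nonneg_of_nonneg_of_le_pi (by linarith [hr.2]) (by linarith [hr.1, hs.2]))
  have := hmono (left_mem_Icc.2 hs.1) (right_mem_Icc.2 hs.1) hs.1
  simpa using this

/-- A function on the sphere whose second differences are dominated by its minimum has a convex
homogeneous extension of degree one. -/
lemma convexOn_norm_mul (hn : 1 ≤ n) {V : 𝔼 → ℝ} (hV : IsHomZero V) {L : ℝ} (hL0 : 0 ≤ L)
    (hL : ∀ x ∈ 𝕊, L ≤ V x)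
    (hdiff : ∀ (a b : 𝔼), ‖a‖ = 1 → ‖b‖ = 1 → ⟪a, b⟫ = 0 → ∀ t : ℝ, 0 < t → t ≤ 1 →
      ∀ x ∈ 𝕊, ∀ y ∈ 𝕊, (V (rotMap a b t x) - V x) - (V (rotMap a b t y) - V y)
        ≤ L * t * ‖x - y‖) :
    ConvexOn ℝ univ fun y => ‖y‖ * V y := by
  have hnonneg : ∀ y : 𝔼, 0 ≤ ‖y‖ * V y := by
    intro y
    rcases eq_or_ne y 0 with rfl | hy
    · simp
    · rw [← eq_unit_of_hom hV.hom hy]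
      exact mul_nonneg (norm_nonneg _) (hL0.trans (hL _ (unit_mem_sphere hy)))
  have hcirc : ∀ a b : 𝔼, ‖a‖ = 1 → ‖b‖ = 1 → ⟪a, b⟫ = 0 → ∀ s ∈ Icc 0 Real.pi,
      V a * Real.cos s + fderiv ℝ V a b * Real.sin s ≤ V (greatCircle a b s) := by
    intro a b ha hb hab s hs
    set h : ℝ → ℝ := fun r => V (greatCircle a b r) with hh
    have hmem := greatCircle_mem ha hb hab
    have hne := fun r => ne_zero_of_mem_unitSphere (hmem r)
    have hcd : ContDiff ℝ 2 h := contDiff_iff_contDiffAt.2 fun r =>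
      (hV.contDiffAt (hne r)).comp r (contDiff_greatCircle a b).contDiffAt
    have hder : ∀ r, HasDerivAt h (deriv h r) r := fun r =>
      (hcd.differentiable (by norm_num) r).hasDerivAt
    have hstep : ∀ r q : ℝ, deriv h r - deriv h q ≤ L * |r - q| := by
      intro r q
      have h1 : Tendsto (fun t : ℝ => t⁻¹ • (h (r + t) - h r) - t⁻¹ • (h (q + t) - h q))
          (𝓝[>] 0) (𝓝 (deriv h r - deriv h q)) :=
        (hder r).tendsto_slope_zero_right.sub (hder q).tendsto_slope_zero_right
      refine le_of_tendsto h1 ?_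
      filter_upwards [Ioc_mem_nhdsGT (zero_lt_one' ℝ)] with t ht
      have h2 := hdiff a b ha hb hab t ht.1 ht.2 _ (hmem r) _ (hmem q)
      rw [rotMap_greatCircle ha hb hab, rotMap_greatCircle ha hb hab] at h2
      have h3 : ‖greatCircle a b r - greatCircle a b q‖ ≤ |r - q| := by
        have h4 := norm_rotMap_sub_le ha hb hab (r - q) (x := greatCircle a b q)
          (by simpa using hmem q)
        rwa [rotMap_greatCircle ha hb hab, add_sub_cancel] at h4
      have h5 := h2.trans (mul_le_mul_of_nonneg_left h3 (mul_nonneg hL0 ht.1.le))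
      rw [← smul_sub, smul_eq_mul, inv_mul_le_iff₀ ht.1]
      simp only [hh]
      linarith
    have hlip : LipschitzWith L.toNNReal (deriv h) := LipschitzWith.of_dist_le_mul fun r q => by
      rw [Real.dist_eq, Real.dist_eq, Real.coe_toNNReal _ hL0]
      have h1 := hstep r q
      have h2 := hstep q r
      rw [abs_sub_comm] at h2
      exact abs_le.2 ⟨by linarith, h1⟩
    have hd2 : ∀ r, -L ≤ deriv (deriv h) r := by
      intro r
      have := norm_deriv_le_of_lipschitz hlip (x₀ := r)
      rw [Real.coe_toNNReal _ hL0, Real.norm_eq_abs] at this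
      exact (abs_le.1 this).1
    have hd0 : deriv h 0 = fderiv ℝ V a b := by
      have hVa : HasFDerivAt V (fderiv ℝ V a) (greatCircle a b 0) := by
        have := (hV.contDiffAt (hne 0)).differentiableAt (by norm_num)
        rw [greatCircle_zero] at this ⊢
        exact this.hasFDerivAt
      have := hVa.comp_hasDerivAt 0 (hasDerivAt_greatCircle a b 0)
      rw [show deriv h 0 = _ from this.deriv]
      simp
    have := sturm_comparison hcd (fun r => hL _ (hmem r)) hd2 hs
    rwa [hd0, show h 0 = V a by simp [hh, greatCircle_zero]] at this
  have hsupp : ∀ a ∈ 𝕊, ∀ y : 𝔼, V a * ⟪a, y⟫ + fderiv ℝ V a y ≤ ‖y‖ * V y := by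
    intro a ha y
    rcases eq_or_ne y 0 with rfl | hy
    · simp
    obtain ⟨b, hb, hab, s, hs, hys⟩ := exists_greatCircle hn ha (unit_mem_sphere hy)
    have hy0 := norm_ne_zero_iff.2 hy
    have hne := ne_zero_of_mem_unitSphere ha
    have haa : fderiv ℝ V a a = 0 := fderiv_apply_self_of_hom hV.hom hne
      ((hV.contDiffAt hne).differentiableAt (by norm_num))
    have ha1 : ‖a‖ = 1 := by simpa using ha
    have h1 := hcirc a b ha1 hb hab s hs
    rw [← hys, eq_unit_of_hom hV.hom hy] at h1
    have hy' : y = ‖y‖ • greatCircle a b s := by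
      rw [← hys, smul_smul, mul_inv_cancel₀ hy0, one_smul]
    have h2 : ⟪a, y⟫ = ‖y‖ * Real.cos s := by
      conv_lhs => rw [hy']
      simp [greatCircle, inner_add_right, inner_smul_right, ha1, hab]
    have h3 : fderiv ℝ V a y = ‖y‖ * (fderiv ℝ V a b * Real.sin s) := by
      conv_lhs => rw [hy']
      simp [greatCircle, haa, mul_comm]
    rw [h2, h3]
    have := mul_le_mul_of_nonneg_left h1 (norm_nonneg y)
    linarith
  refine ⟨convex_univ, fun x _ y _ α β hα hβ _ => ?_⟩
  simp only [smul_eq_mul]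
  rcases eq_or_ne (α • x + β • y) 0 with h0 | h0
  · rw [h0, norm_zero, zero_mul]
    exact add_nonneg (mul_nonneg hα (hnonneg x)) (mul_nonneg hβ (hnonneg y))
  · set z := α • x + β • y with hz
    set a := ‖z‖⁻¹ • z with ha
    have hz0 := norm_ne_zero_iff.2 h0
    have haS := unit_mem_sphere h0
    have hne := ne_zero_of_mem_unitSphere haS
    have haa : fderiv ℝ V a a = 0 := fderiv_apply_self_of_hom hV.hom hne
      ((hV.contDiffAt hne).differentiableAt (by norm_num))
    have hza : z = ‖z‖ • a := by rw [ha, smul_smul, mul_inv_cancel₀ hz0, one_smul]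
    have h1 : V a * ⟪a, z⟫ + fderiv ℝ V a z = ‖z‖ * V z := by
      have h2 : ⟪a, z⟫ = ‖z‖ := by
        rw [ha, inner_smul_left, real_inner_self_eq_norm_sq]
        simp
        field_simp
      have h3 : fderiv ℝ V a z = 0 := by
        rw [hza, map_smul, haa, smul_zero]
      rw [h2, h3, ← eq_unit_of_hom hV.hom h0]
      ring
    rw [← h1, hz, inner_add_right, inner_smul_right, inner_smul_right, map_add, map_smul, map_smul,
      smul_eq_mul, smul_eq_mul]
    have hx := mul_le_mul_of_nonneg_left (hsupp a haS x) hα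
    have hy := mul_le_mul_of_nonneg_left (hsupp a haS y) hβ
    linarith

end Convexity

section GammaBound

open Filter Topology

variable {n : ℕ}

local notation "𝔼" => EuclideanSpace ℝ (Fin (n + 1))

lemma coord_sq_le_norm_sq (z : 𝔼) (i : Fin (n + 1)) : z i ^ 2 ≤ ‖z‖ ^ 2 := by
  rw [← sq_abs, ← Real.norm_eq_abs]
  exact pow_le_pow_left₀ (norm_nonneg _) (PiLp.norm_apply_le z i) 2

lemma norm_add_single_sq (z : 𝔼) : ‖z + EuclideanSpace.single 0 1‖ ^ 2 = ‖z‖ ^ 2 + 2 * z 0 + 1 := by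
  rw [norm_add_sq_real, inner_single_one]
  simp

lemma kernel_le (z : 𝔼) :
    (‖z‖ ^ (n + 2))⁻¹ * (‖z‖ ^ 2 - z 0 ^ 2) * (‖z + EuclideanSpace.single 0 1‖ ^ 2)⁻¹ ≤
      (‖z + EuclideanSpace.single 0 1 - EuclideanSpace.single (0 : Fin (n + 1)) (1 : ℝ)‖
        ^ (n + 1))⁻¹ * ‖z + EuclideanSpace.single 0 1‖⁻¹ *
        Real.arccos ⟪‖z + EuclideanSpace.single 0 1‖⁻¹ • (z + EuclideanSpace.single 0 1),
          EuclideanSpace.single (0 : Fin (n + 1)) (1 : ℝ)⟫ ^ (1 : ℝ) := by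
  have hw2 := norm_add_single_sq z
  have hw0 : (z + EuclideanSpace.single (0 : Fin (n + 1)) (1 : ℝ) : 𝔼) 0 = z 0 + 1 := by simp
  have hT := coord_sq_le_norm_sq z 0
  rw [Real.rpow_one, add_sub_cancel_right]
  set w := z + EuclideanSpace.single 0 (1 : ℝ) with hw
  rcases eq_or_ne w 0 with h | h
  · simp [h]
  rcases eq_or_ne z 0 with hz | hz
  · simp [hz]
  have hr := norm_pos_iff.2 h
  have hz' := norm_pos_iff.2 hz
  have hc : ⟪‖w‖⁻¹ • w, EuclideanSpace.single (0 : Fin (n + 1)) (1 : ℝ)⟫ = (z 0 + 1) / ‖w‖ := by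
    rw [inner_smul_left, inner_single_one, hw0]
    simp
    ring
  rw [hc]
  set c := (z 0 + 1) / ‖w‖ with hcdef
  set T := ‖z‖ ^ 2 - z 0 ^ 2 with hTdef
  have hT0 : 0 ≤ T := by linarith
  have h1 : 1 - c ^ 2 = T / ‖w‖ ^ 2 := by
    rw [hcdef, div_pow, eq_div_iff (by positivity), sub_mul, div_mul_cancel₀ _ (by positivity), hw2]
    ring
  have h2 : √T / ‖w‖ ≤ Real.arccos c := by
    have := Real.sin_le (Real.arccos_nonneg c)
    rwa [Real.sin_arccos, h1, Real.sqrt_div hT0, Real.sqrt_sq hr.le] at this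
  have h3 : T ≤ √T * ‖z‖ := by
    have h4 : √T ≤ ‖z‖ := Real.sqrt_le_iff.2 ⟨hz'.le, by rw [hTdef]; linarith [sq_nonneg (z 0)]⟩
    calc T = √T * √T := (Real.mul_self_sqrt hT0).symm
      _ ≤ _ := by gcongr
  calc (‖z‖ ^ (n + 2))⁻¹ * T * (‖w‖ ^ 2)⁻¹ ≤ (‖z‖ ^ (n + 2))⁻¹ * (√T * ‖z‖) * (‖w‖ ^ 2)⁻¹ := by
        gcongr
    _ = (‖z‖ ^ (n + 1))⁻¹ * ‖w‖⁻¹ * (√T / ‖w‖) := by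
        rw [pow_succ ‖z‖ (n + 1)]
        field_simp
    _ ≤ _ := by gcongr

lemma two_inv_le (z : 𝔼) :
    (‖z‖ ^ (n + 2))⁻¹ * (‖z‖ ^ 2 - z 0 ^ 2) * (1 + ‖z‖ ^ 2)⁻¹ ≤
      ((‖z‖ ^ (n + 2))⁻¹ * (‖z‖ ^ 2 - z 0 ^ 2) * (‖z + EuclideanSpace.single 0 1‖ ^ 2)⁻¹ +
      (‖-z‖ ^ (n + 2))⁻¹ * (‖-z‖ ^ 2 - (-z) 0 ^ 2) * (‖-z + EuclideanSpace.single 0 1‖ ^ 2)⁻¹) / 2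
    := by
  rw [norm_add_single_sq, norm_add_single_sq, norm_neg, PiLp.neg_apply, neg_sq]
  have hT := coord_sq_le_norm_sq z 0
  set T := ‖z‖ ^ 2 - z 0 ^ 2 with hTdef
  set r := ‖z‖ ^ 2 with hr
  rcases (sub_nonneg.2 hT).eq_or_lt with h0 | h0
  · simp [hTdef, ← h0]
  have h1 : 0 < r + 2 * z 0 + 1 := by nlinarith [sq_nonneg (z 0 + 1)]
  have h2 : 0 < r + 2 * -z 0 + 1 := by nlinarith [sq_nonneg (z 0 - 1)]
  have h3 : (1 + r)⁻¹ ≤ ((r + 2 * z 0 + 1)⁻¹ + (r + 2 * -z 0 + 1)⁻¹) / 2 := by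
    have hr0 : 0 < 1 + r := by positivity
    rw [inv_add_inv h1.ne' h2.ne', div_div, inv_eq_one_div, div_le_div_iff₀ hr0 (by positivity)]
    nlinarith [sq_nonneg (z 0)]
  have h4 : 0 ≤ (‖z‖ ^ (n + 2))⁻¹ * T := by positivity
  have := mul_le_mul_of_nonneg_left h3 h4
  linarith

lemma integral_inv_norm_pow_mul :
    ∫ z : 𝔼, (‖z‖ ^ n)⁻¹ * (1 + ‖z‖ ^ 2)⁻¹ = omega_n n * (Real.pi / 2) := by
  have h := integral_fun_norm_addHaar (volume : Measure 𝔼)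
    fun r : ℝ => (r ^ n)⁻¹ * (1 + r ^ 2)⁻¹
  rw [h]
  have h1 : ∫ y in Ioi (0 : ℝ), y ^ (Module.finrank ℝ 𝔼 - 1) • ((y ^ n)⁻¹ * (1 + y ^ 2)⁻¹) =
      ∫ y in Ioi (0 : ℝ), (1 + y ^ 2)⁻¹ := by
    refine setIntegral_congr_fun measurableSet_Ioi fun y hy => ?_
    have hy' : (0 : ℝ) < y := hy
    simp only [finrank_euclideanSpace, Fintype.card_fin, Nat.add_sub_cancel, smul_eq_mul]
    field_simp
  rw [h1, integral_Ioi_inv_one_add_sq, Real.arctan_zero, sub_zero, nsmul_eq_mul, smul_eq_mul,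
    ← mul_assoc, ← Measure.toSphere_real_apply_univ]
  rfl

lemma integral_coord_defect
    (hint : Integrable fun z : 𝔼 => (‖z‖ ^ (n + 2))⁻¹ * (‖z‖ ^ 2 - z 0 ^ 2) * (1 + ‖z‖ ^ 2)⁻¹) :
    (n + 1) * ∫ z : 𝔼, (‖z‖ ^ (n + 2))⁻¹ * (‖z‖ ^ 2 - z 0 ^ 2) * (1 + ‖z‖ ^ 2)⁻¹ =
      n * (omega_n n * (Real.pi / 2)) := by
  set j : Fin (n + 1) → 𝔼 → ℝ := fun i z =>
    (‖z‖ ^ (n + 2))⁻¹ * (‖z‖ ^ 2 - z i ^ 2) * (1 + ‖z‖ ^ 2)⁻¹ with hj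
  have hswap : ∀ i, j i = j 0 ∘
      LinearIsometryEquiv.piLpCongrLeft 2 ℝ ℝ (Equiv.swap i (0 : Fin (n + 1))) := by
    intro i
    funext z
    simp [hj, LinearIsometryEquiv.piLpCongrLeft_apply,
      Equiv.piCongrLeft']
  have hmp : ∀ i, MeasurePreserving
      (LinearIsometryEquiv.piLpCongrLeft 2 ℝ ℝ (Equiv.swap i (0 : Fin (n + 1)))) := fun i =>
    LinearIsometryEquiv.measurePreserving _
  have hemb : ∀ i, MeasurableEmbedding
      (LinearIsometryEquiv.piLpCongrLeft 2 ℝ ℝ (Equiv.swap i (0 : Fin (n + 1)))) := fun i =>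
    (LinearIsometryEquiv.piLpCongrLeft 2 ℝ ℝ
      (Equiv.swap i (0 : Fin (n + 1)))).toHomeomorph.measurableEmbedding
  have hji : ∀ i, Integrable (j i) := fun i => by
    rw [hswap i]
    exact ((hmp i).integrable_comp_emb (hemb i)).2 hint
  have hjint : ∀ i, ∫ z, j i z = ∫ z, j 0 z := fun i => by
    rw [hswap i]
    exact (hmp i).integral_comp (hemb i) _
  have hsum : ∫ z, ∑ i, j i z = (n + 1) * ∫ z, j 0 z := by
    rw [integral_finsetSum _ fun i _ => hji i, Finset.sum_congr rfl fun i _ => hjint i]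
    simp
  rw [show (∫ z : 𝔼, (‖z‖ ^ (n + 2))⁻¹ * (‖z‖ ^ 2 - z 0 ^ 2) * (1 + ‖z‖ ^ 2)⁻¹) = ∫ z, j 0 z from
    rfl, ← hsum, ← integral_inv_norm_pow_mul, ← integral_const_mul]
  refine integral_congr_ae ?_
  have hne : ∀ᵐ z : 𝔼, z ≠ 0 := by simp [ae_iff]
  filter_upwards [hne] with z hz
  have hz' := norm_pos_iff.2 hz
  simp only [hj]
  rw [← Finset.sum_mul, ← Finset.mul_sum, Finset.sum_sub_distrib, ← EuclideanSpace.real_norm_sq_eq]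
  simp only [Finset.sum_const, Finset.card_univ, Fintype.card_fin, nsmul_eq_mul]
  push_cast
  field_simp
  ring

lemma gammaConst_le (hn : 1 ≤ n) : gammaConst n 1 ≤ 2 / (Real.pi * n ^ 2) := by
  have hn0 : (0 : ℝ) < n := by exact_mod_cast hn
  have hω : 0 ≤ omega_n n := ENNReal.toReal_nonneg
  set e : 𝔼 := EuclideanSpace.single (0 : Fin (n + 1)) (1 : ℝ) with he
  set g : 𝔼 → ℝ := fun y => (‖y - e‖ ^ (n + 1))⁻¹ * ‖y‖⁻¹ *
        Real.arccos ⟪‖y‖⁻¹ • y, e⟫ ^ (1 : ℝ) with hg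
  have hγ : gammaConst n 1 = omega_n n / (n * (n + 1)) * (∫ y, g y)⁻¹ := rfl
  rw [hγ]
  by_cases hint : Integrable g
  swap
  · rw [integral_undef hint, inv_zero, mul_zero]
    positivity
  set k : 𝔼 → ℝ := fun z => (‖z‖ ^ (n + 2))⁻¹ * (‖z‖ ^ 2 - z 0 ^ 2) * (‖z + e‖ ^ 2)⁻¹ with hk
  set j : 𝔼 → ℝ := fun z => (‖z‖ ^ (n + 2))⁻¹ * (‖z‖ ^ 2 - z 0 ^ 2) * (1 + ‖z‖ ^ 2)⁻¹ with hj
  have hgi : Integrable fun z => g (z + e) := hint.comp_add_right e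
  have hk0 : ∀ z, 0 ≤ k z := fun z => by
    have := sub_nonneg.2 (coord_sq_le_norm_sq z 0)
    positivity
  have hj0 : ∀ z, 0 ≤ j z := fun z => by
    have := sub_nonneg.2 (coord_sq_le_norm_sq z 0)
    positivity
  have hkg : ∀ z, k z ≤ g (z + e) := kernel_le
  have hki : Integrable k := by
    refine hgi.mono' (Measurable.aestronglyMeasurable (by fun_prop))
      (Eventually.of_forall fun z => ?_)
    rw [Real.norm_eq_abs, abs_of_nonneg (hk0 z)]
    exact hkg z
  have hs : Integrable fun z => (k z + k (-z)) / 2 := (hki.add hki.comp_neg).div_const 2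
  have hjk : ∀ z, j z ≤ (k z + k (-z)) / 2 := two_inv_le
  have hji : Integrable j := by
    refine hs.mono' (Measurable.aestronglyMeasurable (by fun_prop))
      (Eventually.of_forall fun z => ?_)
    rw [Real.norm_eq_abs, abs_of_nonneg (hj0 z)]
    exact hjk z
  have h1 : ∫ z, j z ≤ ∫ z, g z := by
    calc ∫ z, j z ≤ ∫ z, (k z + k (-z)) / 2 := integral_mono hji hs hjk
      _ = ∫ z, k z := by
        rw [integral_div, integral_add hki hki.comp_neg, integral_neg_eq_self]
        ring
      _ ≤ ∫ z, g (z + e) := integral_mono hki hgi hkg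
      _ = ∫ z, g z := integral_add_right_eq_self g e
  have h2 := integral_coord_defect hji
  rcases hω.eq_or_lt with h0 | h0
  · rw [← h0]
    simp
    positivity
  have h3 : omega_n n * (Real.pi / 2) * n / (n + 1) ≤ ∫ z, g z := by
    rw [div_le_iff₀ (by positivity)]
    have := mul_le_mul_of_nonneg_left h1 (show (0 : ℝ) ≤ n + 1 by positivity)
    linarith
  calc omega_n n / (n * (n + 1)) * (∫ y, g y)⁻¹
      ≤ omega_n n / (n * (n + 1)) * (omega_n n * (Real.pi / 2) * n / (n + 1))⁻¹ := by
        gcongr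
    _ = 2 / (Real.pi * n ^ 2) := by
        field_simp

end GammaBound

section HomogeneousExtension

open Filter Topology

variable {n : ℕ}

local notation "𝔼" => EuclideanSpace ℝ (Fin (n + 1))
local notation "𝕊" => sphere (0 : EuclideanSpace ℝ (Fin (n + 1))) 1

lemma laplacian_norm_mul {V : 𝔼 → ℝ} (hV : IsHomZero V) {x : 𝔼} (hx : x ∈ 𝕊) :
    laplacian (fun y => ‖y‖ * V y) x = n * V x + laplacian V x := by
  have hne := ne_zero_of_mem_unitSphere hx
  have hx1 : ‖x‖ = 1 := by simpa using hx
  have h0 : ∑ i, x i * fderiv ℝ V x (EuclideanSpace.single i 1) = 0 := by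
    have h := congrArg (fderiv ℝ V x) (sum_coord_smul x)
    rw [map_sum] at h
    simp only [map_smul, smul_eq_mul] at h
    rw [h]
    exact fderiv_apply_self_of_hom hV.hom hne
      ((hV.contDiffAt hne).differentiableAt (by norm_num))
  rw [laplacian_mul (contDiffAt_norm_two hne) (hV.contDiffAt hne), laplacian_norm hx, hx1]
  simp only [fderiv_norm_single hx]
  rw [h0]
  ring

lemma laplacian_of_hom_one {u : 𝔼 → ℝ} (hu : ContDiffOn ℝ 2 u {0}ᶜ)
    (hhom : ∀ t : ℝ, 0 < t → ∀ y, y ≠ 0 → u (t • y) = t * u y) {y : 𝔼} (hy : y ≠ 0) :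
    laplacian u y = ‖y‖⁻¹ * laplacian u (‖y‖⁻¹ • y) := by
  have hx0 := ne_zero_of_mem_unitSphere (unit_mem_sphere hy)
  have hy' := norm_pos_iff.2 hy
  set x := ‖y‖⁻¹ • y with hx
  have hyx : ‖y‖ • x = y := by rw [hx, smul_smul, mul_inv_cancel₀ hy'.ne', one_smul]
  have h1 := laplacian_comp_smul (u := u) (x := x) (t := ‖y‖)
    (by rw [hyx]; exact contDiffAt_of_contDiffOn_compl hu hy)
  have h2 : laplacian (fun z => u (‖y‖ • z)) x = ‖y‖ * laplacian u x := by
    have hux := contDiffAt_of_contDiffOn_compl hu hx0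
    have h3 := laplacian_linear hux hux ‖y‖ 0
    rw [zero_mul, add_zero] at h3
    rw [← h3]
    refine laplacian_congr ?_
    filter_upwards [isOpen_compl_singleton.mem_nhds hx0] with z hz
    rw [hhom _ hy' z hz]
    ring
  rw [h2, hyx] at h1
  field_simp
  refine mul_left_cancel₀ hy'.ne' ?_
  linarith

lemma isHomZero_div_norm {u : 𝔼 → ℝ} (hu : ContDiffOn ℝ 2 u {0}ᶜ)
    (hhom : ∀ t : ℝ, 0 < t → ∀ y, y ≠ 0 → u (t • y) = t * u y) :
    IsHomZero fun y => u y / ‖y‖ := by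
  refine ⟨fun y hy => ?_, fun t ht y hy => ?_⟩
  · exact ((contDiffAt_of_contDiffOn_compl hu hy).div (contDiffAt_norm_two hy)
      (norm_ne_zero_iff.2 hy)).contDiffWithinAt
  · rw [hhom t ht y hy, norm_smul, Real.norm_eq_abs, abs_of_pos ht, mul_div_mul_left _ _ ht.ne']

lemma map_zero_of_convexOn_of_hom {u : 𝔼 → ℝ} (hu : ConvexOn ℝ univ u)
    (hhom : ∀ t : ℝ, 0 < t → ∀ y, y ≠ 0 → u (t • y) = t * u y) : u 0 = 0 := by
  obtain ⟨x, hx⟩ := exists_ne (0 : 𝔼)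
  have hlow : 0 ≤ u 0 := by
    have h1 := hu.2 (mem_univ x) (mem_univ 0) (by norm_num : (0 : ℝ) ≤ 1 / 2)
      (by norm_num : (0 : ℝ) ≤ 1 / 2) (by norm_num)
    rw [smul_zero, add_zero, hhom _ (by norm_num) x hx] at h1
    simp only [smul_eq_mul] at h1
    linarith
  have hup : ∀ t : ℝ, 0 < t → u 0 ≤ t * ((u x + u (-x)) / 2) := by
    intro t ht
    have h1 := hu.2 (mem_univ (t • x)) (mem_univ (t • -x)) (by norm_num : (0 : ℝ) ≤ 1 / 2)
      (by norm_num : (0 : ℝ) ≤ 1 / 2) (by norm_num)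
    rw [hhom t ht x hx, hhom t ht _ (neg_ne_zero.2 hx), ← smul_add, ← smul_add, add_neg_cancel,
      smul_zero, smul_zero] at h1
    simp only [smul_eq_mul] at h1
    linarith
  refine le_antisymm ?_ hlow
  have hlim : Tendsto (fun t : ℝ => t * ((u x + u (-x)) / 2)) (𝓝[>] 0) (𝓝 0) := by
    have : Tendsto (fun t : ℝ => t * ((u x + u (-x)) / 2)) (𝓝 0) (𝓝 (0 * _)) :=
      tendsto_id.mul_const _
    rw [zero_mul] at this
    exact this.mono_left nhdsWithin_le_nhds
  exact ge_of_tendsto hlim (by filter_upwards [self_mem_nhdsWithin] with t ht using hup t ht)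

/-- Uniqueness of solutions, in the form of an inequality. -/
lemma solution_le {p : ℝ} (hp : 2 < p) {f u v : 𝔼 → ℝ} (hf : ∀ y, y ≠ 0 → 0 < f y)
    (hu0 : ∀ y, y ≠ 0 → 0 < u y)
    (huh : ∀ t : ℝ, 0 < t → ∀ y, y ≠ 0 → u (t • y) = t * u y) (hu : ContDiffOn ℝ 2 u {0}ᶜ)
    (huf : ∀ y, y ≠ 0 → laplacian u y = f y * u y ^ (p - 1))
    (hv0 : ∀ y, y ≠ 0 → 0 < v y)
    (hvh : ∀ t : ℝ, 0 < t → ∀ y, y ≠ 0 → v (t • y) = t * v y) (hv : ContDiffOn ℝ 2 v {0}ᶜ)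
    (hvf : ∀ y, y ≠ 0 → laplacian v y = f y * v y ^ (p - 1)) {y : 𝔼} (hy : y ≠ 0) :
    u y ≤ v y := by
  have key : ∀ w : 𝔼 → ℝ, (∀ t : ℝ, 0 < t → ∀ y, y ≠ 0 → w (t • y) = t * w y) →
      ContDiffOn ℝ 2 w {0}ᶜ → (∀ y, y ≠ 0 → laplacian w y = f y * w y ^ (p - 1)) → ∀ x ∈ 𝕊,
      laplacian (fun y => w y / ‖y‖) x = f x * (w x / ‖x‖) ^ (p - 1) - n * (w x / ‖x‖) := by
    intro w hwh hw hwf x hx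
    have hne := ne_zero_of_mem_unitSphere hx
    have hx1 : ‖x‖ = 1 := by simpa using hx
    have h1 := laplacian_norm_mul (isHomZero_div_norm hw hwh) hx
    have h2 : laplacian (fun y => ‖y‖ * (w y / ‖y‖)) x = laplacian w x := by
      refine laplacian_congr ?_
      filter_upwards [isOpen_compl_singleton.mem_nhds hne] with z hz
      exact mul_div_cancel₀ _ (norm_ne_zero_iff.2 hz)
    rw [h2, hwf x hne] at h1
    rw [hx1, div_one] at h1 ⊢
    linarith
  have hpos : ∀ w : 𝔼 → ℝ, (∀ y, y ≠ 0 → 0 < w y) → ∀ x ∈ 𝕊, 0 < w x / ‖x‖ := fun w hw x hx => by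
    have hne := ne_zero_of_mem_unitSphere hx
    exact div_pos (hw x hne) (norm_pos_iff.2 hne)
  have h1 := solution_comparison hp (isHomZero_div_norm hu huh) (isHomZero_div_norm hv hvh)
    (hpos u hu0) (hpos v hv0) (key u huh hu huf) (key v hvh hv hvf)
    (fun x hx => hf x (ne_zero_of_mem_unitSphere hx)) (κ := 1) (fun x _ => by rw [one_mul])
    _ (unit_mem_sphere hy)
  rw [one_mul, eq_unit_of_hom (P := fun y => u y / ‖y‖) (isHomZero_div_norm hu huh).hom hy,
    eq_unit_of_hom (P := fun y => v y / ‖y‖) (isHomZero_div_norm hv hvh).hom hy,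
    Real.rpow_le_rpow_iff (div_pos (hu0 y hy) (norm_pos_iff.2 hy)).le
      (div_pos (hv0 y hy) (norm_pos_iff.2 hy)).le (by linarith),
    div_le_div_iff_of_pos_right (norm_pos_iff.2 hy)] at h1
  exact h1

lemma continuousOn_sphereGrad {f : 𝔼 → ℝ} (hf : ContDiffOn ℝ 1 f {0}ᶜ) :
    ContinuousOn (sphereGrad f) 𝕊 := by
  have hsub : 𝕊 ⊆ {0}ᶜ := fun y hy => ne_zero_of_mem_unitSphere hy
  have h1 : ContinuousOn (gradient f) 𝕊 := by
    have h2 : ContinuousOn (fderiv ℝ f) {0}ᶜ :=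
      hf.continuousOn_fderiv_of_isOpen isOpen_compl_singleton le_rfl
    exact (InnerProductSpace.toDual ℝ 𝔼).symm.continuous.comp_continuousOn (h2.mono hsub)
  exact h1.sub ((h1.inner (𝕜 := ℝ) continuousOn_id).smul continuousOn_id)

lemma abs_comp_rotMap_sub_le {f : 𝔼 → ℝ} (hf : ContDiffOn ℝ 1 f {0}ᶜ) {G : ℝ}
    (hG : ∀ x ∈ 𝕊, ‖sphereGrad f x‖ ≤ G) {a b : 𝔼} (ha : ‖a‖ = 1) (hb : ‖b‖ = 1)
    (hab : ⟪a, b⟫ = 0) (t : ℝ) {x : 𝔼} (hx : x ∈ 𝕊) : |f (rotMap a b t x) - f x| ≤ G * |t| := by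
  have hx0 := ne_zero_of_mem_unitSphere hx
  have hd := hasDerivAt_comp_rotMap ha hb hab hf hx0
  have hmem : ∀ s, rotMap a b s x ∈ 𝕊 := fun s => by
    rw [mem_sphere_zero_iff_norm, norm_rotMap ha hb hab]
    simpa using hx
  have hbound : ∀ s, ‖fderiv ℝ f (rotMap a b s x) (rotGen a b (rotMap a b s x))‖ ≤ G := by
    intro s
    have hz := hmem s
    set z := rotMap a b s x with hzdef
    have hz1 : ‖z‖ = 1 := by simpa using hz
    have h1 : fderiv ℝ f z (rotGen a b z) = ⟪sphereGrad f z, rotGen a b z⟫ := by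
      have h2 : fderiv ℝ f z (rotGen a b z) = ⟪gradient f z, rotGen a b z⟫ := by
        rw [gradient, InnerProductSpace.toDual_symm_apply]
      have h4 : ⟪z, rotGen a b z⟫ = 0 := by rw [real_inner_comm, inner_rotGen_self]
      rw [h2, sphereGrad, inner_sub_left, inner_smul_left, h4, mul_zero, sub_zero]
    rw [h1]
    refine (norm_inner_le_norm _ _).trans ?_
    have h3 := norm_rotGen_le ha hb hab z
    rw [hz1] at h3
    calc ‖sphereGrad f z‖ * ‖rotGen a b z‖ ≤ G * 1 :=
          mul_le_mul (hG z hz) h3 (norm_nonneg _) ((norm_nonneg _).trans (hG z hz))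
      _ = G := mul_one G
  have := convex_univ.norm_image_sub_le_of_norm_hasDerivWithin_le (C := G)
    (fun s _ => (hd s).hasDerivWithinAt) (fun s _ => hbound s) (mem_univ (0 : ℝ)) (mem_univ t)
  simpa [rotMap_zero] using this

lemma smallness {n : ℕ} (hn : 2 ≤ n) {p m M G E : ℝ} (hp : 2 < p) (hm : 0 < m) (hmM : m ≤ M)
    (hG : 0 ≤ G) (hE : 0 ≤ E)
    (h : (1 + (n * (p - 1) / (n - 1)) * (M / m)) * Real.exp E ^ (p - 1) * G ≤ gammaConst n 1 * m) :
    Real.pi * n * (G / m) ≤ 1 / 3 := by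
  have hn' : (2 : ℝ) ≤ n := by exact_mod_cast hn
  have hpi := Real.pi_pos
  have h1 : (1 : ℝ) ≤ M / m := (one_le_div hm).2 hmM
  have h2 : (1 : ℝ) ≤ Real.exp E ^ (p - 1) :=
    Real.one_le_rpow (Real.one_le_exp hE) (by linarith)
  have hn1 : (0 : ℝ) < n - 1 := by linarith
  have h3 : (n : ℝ) / (n - 1) ≤ (n * (p - 1) / (n - 1)) * (M / m) := by
    have h4 : (n : ℝ) / (n - 1) ≤ n * (p - 1) / (n - 1) := by
      gcongr
      nlinarith
    have h5 : (0 : ℝ) ≤ n / (n - 1) := by positivity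
    nlinarith
  have h6 : (1 + (n : ℝ) / (n - 1)) * G ≤ 2 / (Real.pi * n ^ 2) * m := by
    refine le_trans ?_ (h.trans (mul_le_mul_of_nonneg_right (gammaConst_le (by omega)) hm.le))
    refine mul_le_mul_of_nonneg_right ?_ hG
    have h5 : (0 : ℝ) ≤ n / (n - 1) := by positivity
    nlinarith
  have h7 : (2 * n - 1) * G * (Real.pi * n ^ 2) ≤ 2 * m * (n - 1) := by
    have h8 : (1 + (n : ℝ) / (n - 1)) * G = (2 * n - 1) * G / (n - 1) := by
      field_simp
      ring
    rw [h8, div_mul_eq_mul_div, div_le_div_iff₀ hn1 (by positivity)] at h6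
    exact h6
  rw [← mul_div_assoc, div_le_iff₀ hm]
  have h9 : 6 * ((n : ℝ) - 1) ≤ n * (2 * n - 1) := by nlinarith
  have h10 : (0 : ℝ) < n * (2 * n - 1) := by
    have : (0 : ℝ) < 2 * n - 1 := by linarith
    positivity
  refine le_of_mul_le_mul_left (a := (n : ℝ) * (2 * n - 1)) ?_ h10
  nlinarith

end HomogeneousExtension

section Assembly

open Filter Topology

variable {n : ℕ}

local notation "𝔼" => EuclideanSpace ℝ (Fin (n + 1))
local notation "𝕊" => sphere (0 : EuclideanSpace ℝ (Fin (n + 1))) 1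

/-- A function on the sphere oscillates by at most `π` times the bound of its gradient. -/
lemma le_add_pi_mul (hn : 1 ≤ n) {f : 𝔼 → ℝ} (hf : ContDiffOn ℝ 1 f {0}ᶜ) {G : ℝ} (hG0 : 0 ≤ G)
    (hG : ∀ x ∈ 𝕊, ‖sphereGrad f x‖ ≤ G) {x y : 𝔼} (hx : x ∈ 𝕊) (hy : y ∈ 𝕊) :
    f y ≤ f x + Real.pi * G := by
  obtain ⟨b, hb, hxb, s, hs, rfl⟩ := exists_greatCircle hn hx hy
  have hx1 : ‖x‖ = 1 := by simpa using hx
  have h := abs_comp_rotMap_sub_le hf hG hx1 hb hxb s hx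
  have h1 := rotMap_greatCircle hx1 hb hxb s 0
  rw [greatCircle_zero, zero_add] at h1
  rw [h1, abs_of_nonneg hs.1] at h
  have h2 := (abs_le.1 h).2
  have h3 := mul_le_mul_of_nonneg_left hs.2 hG0
  linarith

lemma norm_mul_solves {p : ℝ} {f V : 𝔼 → ℝ}
    (hf : ∀ t : ℝ, 0 < t → ∀ y, y ≠ 0 → f (t • y) = t ^ (-p) * f y) (hV : IsHomZero V)
    (hV0 : ∀ x ∈ 𝕊, 0 < V x)
    (hVf : ∀ x ∈ 𝕊, laplacian V x = f x * V x ^ (p - 1) - n * V x) :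
    (∀ y, y ≠ 0 → 0 < ‖y‖ * V y) ∧
      (∀ t : ℝ, 0 < t → ∀ y, y ≠ 0 → ‖t • y‖ * V (t • y) = t * (‖y‖ * V y)) ∧
      ContDiffOn ℝ 2 (fun y => ‖y‖ * V y) {0}ᶜ ∧
      ∀ y, y ≠ 0 → laplacian (fun y => ‖y‖ * V y) y = f y * (‖y‖ * V y) ^ (p - 1) := by
  have hpos : ∀ y, y ≠ 0 → 0 < V y := fun y hy => by
    rw [← eq_unit_of_hom hV.hom hy]
    exact hV0 _ (unit_mem_sphere hy)
  have hhom : ∀ t : ℝ, 0 < t → ∀ y, y ≠ 0 → ‖t • y‖ * V (t • y) = t * (‖y‖ * V y) := by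
    intro t ht y hy
    rw [hV.hom t ht y hy, norm_smul, Real.norm_eq_abs, abs_of_pos ht, mul_assoc]
  have hC : ContDiffOn ℝ 2 (fun y => ‖y‖ * V y) {0}ᶜ := fun y hy =>
    ((contDiffAt_norm_two hy).mul (hV.contDiffAt hy)).contDiffWithinAt
  refine ⟨fun y hy => mul_pos (norm_pos_iff.2 hy) (hpos y hy), hhom, hC, fun y hy => ?_⟩
  have hy' := norm_pos_iff.2 hy
  rw [laplacian_of_hom_one hC hhom hy, laplacian_norm_mul hV (unit_mem_sphere hy),
    hVf _ (unit_mem_sphere hy), eq_unit_of_hom hV.hom hy, hf _ (inv_pos.2 hy') y hy,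
    Real.mul_rpow hy'.le (hpos y hy).le, Real.inv_rpow hy'.le, Real.rpow_neg hy'.le, inv_inv,
    Real.rpow_sub_one hy'.ne']
  ring

end Assembly

/-- existence and uniqueness of a convex solution to the `L_p`
Christoffel problem, `p > 2`, under a smallness condition on the gradient of `f`. -/
theorem stmt_16 (n : ℕ) (hn : 2 ≤ n) (p : ℝ) (hp : 2 < p)
    (f : EuclideanSpace ℝ (Fin (n + 1)) → ℝ)
    (hf_pos : ∀ y : EuclideanSpace ℝ (Fin (n + 1)), y ≠ 0 → 0 < f y)
    (hf_C1 : ContDiffOn ℝ 1 f {(0 : EuclideanSpace ℝ (Fin (n + 1)))}ᶜ)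
    (hf_hom : ∀ t : ℝ, 0 < t → ∀ y : EuclideanSpace ℝ (Fin (n + 1)), y ≠ 0 →
      f (t • y) = t ^ (-p) * f y)
    (hcond :
      (1 + (n * (p - 1) / (n - 1)) *
          (sSup (f '' sphere (0 : EuclideanSpace ℝ (Fin (n + 1))) 1) /
            sInf (f '' sphere (0 : EuclideanSpace ℝ (Fin (n + 1))) 1))) *
        Real.exp ((n * Real.pi / (n - 1)) *
          (sSup ((fun x => ‖sphereGrad f x‖) '' sphere (0 : EuclideanSpace ℝ (Fin (n + 1))) 1) /
            sInf (f '' sphere (0 : EuclideanSpace ℝ (Fin (n + 1))) 1))) ^ (p - 1) *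
        sSup ((fun x => ‖sphereGrad f x‖) '' sphere (0 : EuclideanSpace ℝ (Fin (n + 1))) 1) ≤
      gammaConst n 1 * sInf (f '' sphere (0 : EuclideanSpace ℝ (Fin (n + 1))) 1)) :
    ∃! u : EuclideanSpace ℝ (Fin (n + 1)) → ℝ,
      ConvexOn ℝ Set.univ u ∧
      (∀ y : EuclideanSpace ℝ (Fin (n + 1)), y ≠ 0 → 0 < u y) ∧
      (∀ t : ℝ, 0 < t → ∀ y : EuclideanSpace ℝ (Fin (n + 1)), y ≠ 0 → u (t • y) = t * u y) ∧
      ContDiffOn ℝ 2 u {(0 : EuclideanSpace ℝ (Fin (n + 1)))}ᶜ ∧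
      (∀ y : EuclideanSpace ℝ (Fin (n + 1)), y ≠ 0 →
        laplacian u y = f y * u y ^ (p - 1)) := by
  have hsub : sphere (0 : EuclideanSpace ℝ (Fin (n + 1))) 1 ⊆ {0}ᶜ :=
    fun y hy => ne_zero_of_mem_unitSphere hy
  have hcomp := isCompact_sphere (0 : EuclideanSpace ℝ (Fin (n + 1))) 1
  have hne : (sphere (0 : EuclideanSpace ℝ (Fin (n + 1))) 1).Nonempty :=
    NormedSpace.sphere_nonempty.2 zero_le_one
  have hfc : IsCompact (f '' sphere (0 : EuclideanSpace ℝ (Fin (n + 1))) 1) :=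
    hcomp.image_of_continuousOn (hf_C1.continuousOn.mono hsub)
  have hgc : IsCompact
      ((fun x => ‖sphereGrad f x‖) '' sphere (0 : EuclideanSpace ℝ (Fin (n + 1))) 1) :=
    hcomp.image_of_continuousOn (continuousOn_sphereGrad hf_C1).norm
  obtain ⟨xm, hxm, hxm'⟩ := hfc.sInf_mem (hne.image f)
  obtain ⟨xM, hxM, hxM'⟩ := hfc.sSup_mem (hne.image f)
  have hfm : ∀ x ∈ sphere (0 : EuclideanSpace ℝ (Fin (n + 1))) 1, sInf (f '' sphere 0 1) ≤ f x :=
    fun x hx => csInf_le hfc.bddBelow (mem_image_of_mem f hx)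
  have hfM : ∀ x ∈ sphere (0 : EuclideanSpace ℝ (Fin (n + 1))) 1, f x ≤ sSup (f '' sphere 0 1) :=
    fun x hx => le_csSup hfc.bddAbove (mem_image_of_mem f hx)
  have hfG : ∀ x ∈ sphere (0 : EuclideanSpace ℝ (Fin (n + 1))) 1,
      ‖sphereGrad f x‖ ≤ sSup ((fun x => ‖sphereGrad f x‖) '' sphere 0 1) :=
    fun x hx => le_csSup hgc.bddAbove (mem_image_of_mem (fun x => ‖sphereGrad f x‖) hx)
  set m := sInf (f '' sphere (0 : EuclideanSpace ℝ (Fin (n + 1))) 1)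
  set M := sSup (f '' sphere (0 : EuclideanSpace ℝ (Fin (n + 1))) 1)
  set G := sSup ((fun x => ‖sphereGrad f x‖) '' sphere (0 : EuclideanSpace ℝ (Fin (n + 1))) 1)
  have hm : 0 < m := hxm' ▸ hf_pos xm (hsub hxm)
  have hG : 0 ≤ G := (norm_nonneg _).trans (hfG xm hxm)
  have hMG : M ≤ m + Real.pi * G := by
    rw [← hxm', ← hxM']
    exact le_add_pi_mul (by omega) hf_C1 hG hfG hxm hxM
  have hn1 : (0 : ℝ) < n - 1 := by
    have : (2 : ℝ) ≤ n := by exact_mod_cast hn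
    linarith
  have hsmall := smallness hn hp hm ((hfm xm hxm).trans (hfM xm hxm)) hG
    (mul_nonneg (div_nonneg (mul_nonneg n.cast_nonneg Real.pi_pos.le) hn1.le)
      (div_nonneg hG hm.le)) hcond
  obtain ⟨V, hV, hV0, hV1, hV2, hVf⟩ := exists_sphere_solution hn hp hf_C1 hm hfm hfM
  obtain ⟨L, hL, hL0, hdiff⟩ :=
    second_difference_le hn hp hV hV0 hVf hm hG hfm hfM hMG hV1 hV2 hsmall
  have hconv : ConvexOn ℝ univ fun y => ‖y‖ * V y := by
    refine convexOn_norm_mul (by omega) hV hL0 hL fun a b ha hb hab t ht ht1 x hx y hy => ?_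
    refine hdiff (rotIso ha hb hab t) t ht.le ht1 (fun z hz => ?_) (fun z hz => ?_) x hx y hy
    · have := norm_rotMap_sub_le ha hb hab t (x := z) (by simpa using hz)
      rwa [abs_of_pos ht] at this
    · have := abs_comp_rotMap_sub_le hf_C1 hfG ha hb hab t hz
      rwa [abs_of_pos ht] at this
  obtain ⟨hU0, hUh, hU, hUf⟩ := norm_mul_solves hf_hom hV hV0 hVf
  refine ⟨fun y => ‖y‖ * V y, ⟨hconv, hU0, hUh, hU, hUf⟩, ?_⟩
  rintro u ⟨huc, hu0, huh, hu, huf⟩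
  funext y
  rcases eq_or_ne y 0 with rfl | hy
  · rw [map_zero_of_convexOn_of_hom huc huh, norm_zero, zero_mul]
  · exact le_antisymm (solution_le hp hf_pos hu0 huh hu huf hU0 hUh hU hUf hy)
      (solution_le hp hf_pos hU0 hUh hU hUf hu0 huh hu huf hy)
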